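/- arXiv:1403.5720 — 4 statements merged into one kernel-verified Lean document; each statement's English description precedes it below -/
import Mathlib

section
/- Let U and V be unitary operators on a tensor product ℂ^{n_1} ⊗ ⋯ ⊗ ℂ^{n_p}, and suppose U = (S_1 ⊗ ⋯ ⊗ S_p) V (T_1 ⊗ ⋯ ⊗ T_p) for invertible matrices S_i, T_i of sizes n_i × n_i. Then there exist unitary matrices Q_i, R_i of sizes n_i × n_i such that U = (Q_1 ⊗ ⋯ ⊗ Q_p) V (R_1 ⊗ ⋯ ⊗ R_p). -/
open Matrix Finset

/-- The Kronecker (tensor) product of a family of square matrices `M i`,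
acting on the tensor product space indexed by dependent functions. -/
noncomputable def kronFamily {p : ℕ} {n : Fin p → ℕ}
    (M : ∀ i, Matrix (Fin (n i)) (Fin (n i)) ℂ) :
    Matrix (∀ i, Fin (n i)) (∀ i, Fin (n i)) ℂ :=
  Matrix.of fun x y => ∏ i, M i (x i) (y i)

section PolarDecomposition

open scoped MatrixOrder ComplexOrder Matrix.Norms.L2Operator

variable {m : Type*} [Fintype m] [DecidableEq m]

/-- Left polar decomposition of an invertible complex matrix. -/
theorem exists_unitary_mul_posSemidef {S : Matrix m m ℂ} (hS : IsUnit S) :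
    ∃ Q ∈ Matrix.unitaryGroup m ℂ, ∃ P : Matrix m m ℂ, P.PosSemidef ∧ S = Q * P := by
  have hpos : 0 ≤ Sᴴ * S := (posSemidef_conjTranspose_mul_self S).nonneg
  set P := CFC.sqrt (Sᴴ * S) with hP
  have hPP : P * P = Sᴴ * S := CFC.sqrt_mul_sqrt_self _ hpos
  have hPpos : P.PosSemidef := (CFC.sqrt_nonneg (Sᴴ * S)).posSemidef
  have hPdet : IsUnit P.det := by
    have hdet : IsUnit (P * P).det := by
      rw [hPP, ← isUnit_iff_isUnit_det]
      exact (star_eq_conjTranspose S ▸ hS.star).mul hS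
    rw [det_mul] at hdet
    exact isUnit_of_mul_isUnit_left hdet
  refine ⟨S * P⁻¹, ?_, P, hPpos, ?_⟩
  · rw [mem_unitaryGroup_iff', star_eq_conjTranspose, conjTranspose_mul,
      conjTranspose_nonsing_inv, hPpos.isHermitian.eq]
    calc P⁻¹ * Sᴴ * (S * P⁻¹) = P⁻¹ * (Sᴴ * S) * P⁻¹ := by simp only [Matrix.mul_assoc]
      _ = P⁻¹ * P * (P * P⁻¹) := by rw [← hPP]; simp only [Matrix.mul_assoc]
      _ = 1 := by rw [nonsing_inv_mul _ hPdet, mul_nonsing_inv _ hPdet, Matrix.one_mul]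
  · rw [Matrix.mul_assoc, nonsing_inv_mul _ hPdet, Matrix.mul_one]

/-- Right polar decomposition of an invertible complex matrix. -/
theorem exists_posSemidef_mul_unitary {T : Matrix m m ℂ} (hT : IsUnit T) :
    ∃ R ∈ Matrix.unitaryGroup m ℂ, ∃ P : Matrix m m ℂ, P.PosSemidef ∧ T = P * R := by
  obtain ⟨Q, hQ, P, hP, h⟩ := exists_unitary_mul_posSemidef hT.star
  refine ⟨star Q, Unitary.star_mem hQ, P, hP, ?_⟩
  rw [← star_star T, h, star_mul, star_eq_conjTranspose P, hP.isHermitian.eq]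

/-- A product of two positive semidefinite matrices is unitary only if it is the identity. -/
theorem Matrix.PosSemidef.mul_eq_one_of_mem_unitaryGroup {A B : Matrix m m ℂ}
    (hA : A.PosSemidef) (hB : B.PosSemidef) (h : A * B ∈ Matrix.unitaryGroup m ℂ) :
    A * B = 1 := by
  have h1 : A * (B * B * A) = 1 := by
    have := mem_unitaryGroup_iff.mp h
    rw [star_eq_conjTranspose, conjTranspose_mul, hA.isHermitian.eq, hB.isHermitian.eq] at this
    simpa only [Matrix.mul_assoc] using this
  have hinv : A⁻¹ = B * B * A := inv_eq_right_inv h1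
  have hdet : IsUnit A.det := isUnit_det_of_right_inverse h1
  have h2 : B * B = A⁻¹ * A⁻¹ := by
    nth_rewrite 1 [hinv]
    rw [Matrix.mul_assoc, mul_nonsing_inv _ hdet, Matrix.mul_one]
  have h3 : B = A⁻¹ := (CFC.mul_self_eq_mul_self_iff B A⁻¹ hB.nonneg hA.inv.nonneg).mp h2
  rw [h3, mul_nonsing_inv _ hdet]

/-- If `U` and `V` are unitary and `U = (q * K) * V * (L * r)` with `q`, `r` unitary and `K`, `L`
positive semidefinite, then the positive factors can be dropped. -/
theorem eq_unitary_mul_of_eq_polar_mul {U V q r K L : Matrix m m ℂ}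
    (hU : U ∈ Matrix.unitaryGroup m ℂ) (hV : V ∈ Matrix.unitaryGroup m ℂ)
    (hq : q ∈ Matrix.unitaryGroup m ℂ) (hr : r ∈ Matrix.unitaryGroup m ℂ)
    (hK : K.PosSemidef) (hL : L.PosSemidef) (h : U = q * K * V * (L * r)) :
    U = q * V * r := by
  have hVV : star V * V = 1 := mem_unitaryGroup_iff'.mp hV
  have hone : K * (V * L * star V) = 1 := by
    refine hK.mul_eq_one_of_mem_unitaryGroup (hL.mul_mul_conjTranspose_same V) ?_
    have hW : K * (V * L * star V) = star q * U * star r * star V := by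
      calc K * (V * L * star V) = 1 * K * V * L * 1 * star V := by
            simp only [Matrix.mul_assoc, Matrix.one_mul]
        _ = star q * q * K * V * L * (r * star r) * star V := by
            rw [mem_unitaryGroup_iff'.mp hq, mem_unitaryGroup_iff.mp hr]
        _ = star q * U * star r * star V := by rw [h]; simp only [Matrix.mul_assoc]
    rw [hW]
    exact mul_mem (mul_mem (mul_mem (Unitary.star_mem hq) hU) (Unitary.star_mem hr))
      (Unitary.star_mem hV)
  calc U = q * (K * (V * L * 1)) * r := by
        rw [h]; simp only [Matrix.mul_assoc, Matrix.mul_one]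
    _ = q * (K * (V * L * star V)) * V * r := by rw [← hVV]; simp only [Matrix.mul_assoc]
    _ = q * V * r := by rw [hone, Matrix.mul_one]

theorem Matrix.PosSemidef.exists_eq_conjTranspose_mul_self {A : Matrix m m ℂ}
    (hA : A.PosSemidef) : ∃ B : Matrix m m ℂ, A = Bᴴ * B := by
  refine ⟨CFC.sqrt A, ?_⟩
  rw [(CFC.sqrt_nonneg A).posSemidef.isHermitian.eq, CFC.sqrt_mul_sqrt_self A hA.nonneg]

end PolarDecomposition

section KronFamily

open scoped ComplexOrder

variable {p : ℕ} {n : Fin p → ℕ}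

theorem kronFamily_mul (M N : ∀ i, Matrix (Fin (n i)) (Fin (n i)) ℂ) :
    kronFamily (fun i => M i * N i) = kronFamily M * kronFamily N := by
  ext x y
  simp only [kronFamily, of_apply, mul_apply, Fintype.prod_sum, prod_mul_distrib]

theorem kronFamily_conjTranspose (M : ∀ i, Matrix (Fin (n i)) (Fin (n i)) ℂ) :
    kronFamily (fun i => (M i)ᴴ) = (kronFamily M)ᴴ := by
  ext x y
  simp [kronFamily, conjTranspose_apply]

theorem kronFamily_one :
    kronFamily (fun i => (1 : Matrix (Fin (n i)) (Fin (n i)) ℂ)) = 1 := by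
  ext x y
  simp only [kronFamily, of_apply, one_apply, Fintype.prod_boole, funext_iff]
  congr

theorem kronFamily_mem_unitaryGroup {M : ∀ i, Matrix (Fin (n i)) (Fin (n i)) ℂ}
    (hM : ∀ i, M i ∈ Matrix.unitaryGroup (Fin (n i)) ℂ) :
    kronFamily M ∈ Matrix.unitaryGroup (∀ i, Fin (n i)) ℂ := by
  rw [mem_unitaryGroup_iff, star_eq_conjTranspose, ← kronFamily_conjTranspose,
    ← kronFamily_mul, ← kronFamily_one]
  exact congrArg kronFamily (funext fun i => mem_unitaryGroup_iff.mp (hM i))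

theorem kronFamily_posSemidef {M : ∀ i, Matrix (Fin (n i)) (Fin (n i)) ℂ}
    (hM : ∀ i, (M i).PosSemidef) : (kronFamily M).PosSemidef := by
  choose B hB using fun i => (hM i).exists_eq_conjTranspose_mul_self
  rw [funext hB, kronFamily_mul, kronFamily_conjTranspose]
  exact posSemidef_conjTranspose_mul_self _

end KronFamily

theorem stmt_2 (p : ℕ) (n : Fin p → ℕ)
    (U V : Matrix (∀ i, Fin (n i)) (∀ i, Fin (n i)) ℂ)
    (hU : U ∈ Matrix.unitaryGroup (∀ i, Fin (n i)) ℂ)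
    (hV : V ∈ Matrix.unitaryGroup (∀ i, Fin (n i)) ℂ)
    (S T : ∀ i, Matrix (Fin (n i)) (Fin (n i)) ℂ)
    (hS : ∀ i, IsUnit (S i)) (hT : ∀ i, IsUnit (T i))
    (h : U = kronFamily S * V * kronFamily T) :
    ∃ Q R : ∀ i, Matrix (Fin (n i)) (Fin (n i)) ℂ,
      (∀ i, Q i ∈ Matrix.unitaryGroup (Fin (n i)) ℂ) ∧
      (∀ i, R i ∈ Matrix.unitaryGroup (Fin (n i)) ℂ) ∧
      U = kronFamily Q * V * kronFamily R := by
  choose Q hQ P hP hQP using fun i => exists_unitary_mul_posSemidef (hS i)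
  choose R hR P' hP' hPR using fun i => exists_posSemidef_mul_unitary (hT i)
  refine ⟨Q, R, hQ, hR, ?_⟩
  rw [funext hQP, funext hPR, kronFamily_mul, kronFamily_mul] at h
  exact eq_unitary_mul_of_eq_polar_mul hU hV (kronFamily_mem_unitaryGroup hQ)
    (kronFamily_mem_unitaryGroup hR) (kronFamily_posSemidef hP) (kronFamily_posSemidef hP') h
end

section
/- Let U and V be unitary operators on ℂ^{d_A} ⊗ ℂ^{d_B} with U = (S_1 ⊗ S_2) V (T_1 ⊗ T_2) for invertible S_1, T_1 (d_A × d_A) and S_2, T_2 (d_B × d_B). Then there exist unitaries Q_1, R_1 (d_A × d_A) and Q_2, R_2 (d_B × d_B) with U = (Q_1 ⊗ Q_2) V (R_1 ⊗ R_2). -/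
open Matrix Kronecker
open scoped ComplexOrder MatrixOrder

/-- Left polar decomposition of an invertible complex matrix. -/
theorem exists_unitary_mul_posDef {n : Type*} [Fintype n] [DecidableEq n] {S : Matrix n n ℂ}
    (hS : IsUnit S) :
    ∃ Q P : Matrix n n ℂ, Q ∈ unitaryGroup n ℂ ∧ P.PosDef ∧ S = Q * P := by
  have hpd : 0 ≤ Sᴴ * S := nonneg_iff_posSemidef.2 (posSemidef_conjTranspose_mul_self S)
  have hSS : IsUnit (Sᴴ * S) := ((isUnit_conjTranspose _).2 hS).mul hS
  set P := CFC.sqrt (Sᴴ * S)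
  have hPP : P * P = Sᴴ * S := CFC.sqrt_mul_sqrt_self _ hpd
  have hPu : IsUnit P := (CFC.isUnit_sqrt_iff _ hpd).2 hSS
  have hPd : P.PosDef :=
    (nonneg_iff_posSemidef.1 (CFC.sqrt_nonneg (Sᴴ * S))).posDef_iff_isUnit.2 hPu
  have hdet : IsUnit P.det := (isUnit_iff_isUnit_det P).1 hPu
  refine ⟨S * P⁻¹, P, mem_unitaryGroup_iff'.2 ?_, hPd, ?_⟩
  · rw [star_eq_conjTranspose, conjTranspose_mul, conjTranspose_nonsing_inv, hPd.isHermitian.eq,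
      Matrix.mul_assoc, ← Matrix.mul_assoc Sᴴ, ← hPP, Matrix.mul_assoc P,
      mul_nonsing_inv P hdet, Matrix.mul_one, nonsing_inv_mul P hdet]
  · rw [Matrix.mul_assoc, nonsing_inv_mul P hdet, Matrix.mul_one]

/-- Right polar decomposition of an invertible complex matrix. -/
theorem exists_posDef_mul_unitary {n : Type*} [Fintype n] [DecidableEq n] {T : Matrix n n ℂ}
    (hT : IsUnit T) :
    ∃ P R : Matrix n n ℂ, P.PosDef ∧ R ∈ unitaryGroup n ℂ ∧ T = P * R := by
  obtain ⟨Q, P, hQ, hP, h⟩ := exists_unitary_mul_posDef ((isUnit_conjTranspose _).2 hT)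
  refine ⟨P, star Q, hP, Unitary.star_mem hQ, ?_⟩
  rw [← conjTranspose_conjTranspose T, h, conjTranspose_mul, hP.isHermitian.eq,
    star_eq_conjTranspose]

theorem Matrix.PosDef.mul_eq_one_of_mem_unitaryGroup {n : Type*} [Fintype n] [DecidableEq n]
    {P K : Matrix n n ℂ} (hP : P.PosDef) (hK : K.PosDef) (h : P * K ∈ unitaryGroup n ℂ) :
    P * K = 1 := by
  have h1 : P * (K * (K * P)) = 1 := by
    have := mem_unitaryGroup_iff.1 h
    rwa [star_eq_conjTranspose, conjTranspose_mul, hP.isHermitian.eq, hK.isHermitian.eq,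
      Matrix.mul_assoc] at this
  have hdet : IsUnit P.det := (isUnit_iff_isUnit_det P).1 hP.isUnit
  have h2 : K * K = P⁻¹ * P⁻¹ := by
    calc K * K = P⁻¹ * (P * (K * (K * P))) * P⁻¹ := by
          rw [nonsing_inv_mul_cancel_left _ _ hdet, ← Matrix.mul_assoc K K P,
            mul_nonsing_inv_cancel_right _ _ hdet]
      _ = P⁻¹ * P⁻¹ := by rw [h1, Matrix.mul_one]
  have h3 : K = P⁻¹ :=
    (CFC.mul_self_eq_mul_self_iff K P⁻¹ (nonneg_iff_posSemidef.2 hK.posSemidef)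
      (nonneg_iff_posSemidef.2 hP.inv.posSemidef)).1 h2
  rw [h3, mul_nonsing_inv P hdet]

/-- Positive definite factors relating two unitaries by two-sided multiplication act trivially. -/
theorem Matrix.PosDef.mul_mul_eq_of_mem_unitaryGroup {n : Type*} [Fintype n] [DecidableEq n]
    {P P' V : Matrix n n ℂ} (hP : P.PosDef) (hP' : P'.PosDef) (hV : V ∈ unitaryGroup n ℂ)
    (h : P * V * P' ∈ unitaryGroup n ℂ) : P * V * P' = V := by
  have hVs : V * star V = 1 := mem_unitaryGroup_iff.1 hV
  have hsV : star V * V = 1 := mem_unitaryGroup_iff'.1 hV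
  have hVu : IsUnit V := IsUnit.of_mul_eq_one _ hVs
  have hK : (V * P' * star V).PosDef :=
    hP'.mul_mul_conjTranspose_same (vecMul_injective_of_isUnit hVu)
  have h1 : P * (V * P' * star V) = 1 := by
    refine hP.mul_eq_one_of_mem_unitaryGroup hK ?_
    simpa only [Matrix.mul_assoc] using mul_mem h (Unitary.star_mem hV)
  calc P * V * P' = P * (V * P' * star V) * V := by
        simp only [Matrix.mul_assoc, hsV, Matrix.mul_one]
    _ = V := by rw [h1, Matrix.one_mul]

theorem stmt_3 (dA dB : ℕ)
    (U V : Matrix (Fin dA × Fin dB) (Fin dA × Fin dB) ℂ)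
    (hU : U ∈ Matrix.unitaryGroup (Fin dA × Fin dB) ℂ)
    (hV : V ∈ Matrix.unitaryGroup (Fin dA × Fin dB) ℂ)
    (S₁ T₁ : Matrix (Fin dA) (Fin dA) ℂ) (S₂ T₂ : Matrix (Fin dB) (Fin dB) ℂ)
    (hS₁ : IsUnit S₁) (hT₁ : IsUnit T₁) (hS₂ : IsUnit S₂) (hT₂ : IsUnit T₂)
    (h : U = (S₁ ⊗ₖ S₂) * V * (T₁ ⊗ₖ T₂)) :
    ∃ (Q₁ R₁ : Matrix (Fin dA) (Fin dA) ℂ) (Q₂ R₂ : Matrix (Fin dB) (Fin dB) ℂ),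
      Q₁ ∈ Matrix.unitaryGroup (Fin dA) ℂ ∧ R₁ ∈ Matrix.unitaryGroup (Fin dA) ℂ ∧
      Q₂ ∈ Matrix.unitaryGroup (Fin dB) ℂ ∧ R₂ ∈ Matrix.unitaryGroup (Fin dB) ℂ ∧
      U = (Q₁ ⊗ₖ Q₂) * V * (R₁ ⊗ₖ R₂) := by
  obtain ⟨Q₁, P₁, hQ₁, hP₁, rfl⟩ := exists_unitary_mul_posDef hS₁
  obtain ⟨Q₂, P₂, hQ₂, hP₂, rfl⟩ := exists_unitary_mul_posDef hS₂
  obtain ⟨P₁', R₁, hP₁', hR₁, rfl⟩ := exists_posDef_mul_unitary hT₁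
  obtain ⟨P₂', R₂, hP₂', hR₂, rfl⟩ := exists_posDef_mul_unitary hT₂
  refine ⟨Q₁, R₁, Q₂, R₂, hQ₁, hR₁, hQ₂, hR₂, ?_⟩
  have hQ : Q₁ ⊗ₖ Q₂ ∈ unitaryGroup (Fin dA × Fin dB) ℂ := kronecker_mem_unitary hQ₁ hQ₂
  have hR : R₁ ⊗ₖ R₂ ∈ unitaryGroup (Fin dA × Fin dB) ℂ := kronecker_mem_unitary hR₁ hR₂
  rw [mul_kronecker_mul, mul_kronecker_mul] at h
  have hP := hP₁.kronecker hP₂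
  have hP' := hP₁'.kronecker hP₂'
  generalize Q₁ ⊗ₖ Q₂ = Q at *
  generalize R₁ ⊗ₖ R₂ = R at *
  generalize P₁ ⊗ₖ P₂ = P at *
  generalize P₁' ⊗ₖ P₂' = P' at *
  have hW : P * V * P' = star Q * U * star R := by
    calc P * V * P' = (star Q * Q) * (P * V * P') * (R * star R) := by
          rw [mem_unitaryGroup_iff'.1 hQ, mem_unitaryGroup_iff.1 hR, Matrix.one_mul,
            Matrix.mul_one]
      _ = star Q * U * star R := by simp only [h, Matrix.mul_assoc]
  have hPV : P * V * P' = V := hP.mul_mul_eq_of_mem_unitaryGroup hP' hV <|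
    hW ▸ mul_mem (mul_mem (Unitary.star_mem hQ) hU) (Unitary.star_mem hR)
  calc U = Q * (P * V * P') * R := by simp only [h, Matrix.mul_assoc]
    _ = Q * V * R := by rw [hPV]
end

section
/- For 2×2 complex matrices: for any m₁×n₁ matrices R_1, R_2 and m₂×n₂ matrices S_1, S_2, rank(R_1 ⊗ S_1ᵀ + R_2 ⊗ S_2ᵀ) ≤ 2 · rank(R_1 ⊗ S_1 + R_2 ⊗ S_2). -/
open Matrix Kronecker

section Chains

variable {K V W : Type*} [Field K] [AddCommGroup V] [Module K V] [AddCommGroup W] [Module K W]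

/-- The image of a subspace of `W` under the linear relation `f ∘ g⁻¹`. -/
def relationMap (f g : V →ₗ[K] W) (U : Submodule K W) : Submodule K W :=
  (U.comap g).map f

theorem exists_chain_of_mem_iterate (f g : V →ₗ[K] W) (U : Submodule K W) (k : ℕ) (x₀ : V)
    (h : g x₀ ∈ (relationMap f g)^[k] U) :
    ∃ x : ℕ → V, x 0 = x₀ ∧ (∀ i < k, f (x (i + 1)) = g (x i)) ∧ g (x k) ∈ U := by
  induction k generalizing x₀ with
  | zero => exact ⟨fun _ => x₀, rfl, by simp, h⟩
  | succ k ih =>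
    rw [Function.iterate_succ_apply'] at h
    obtain ⟨v, hv, hfv⟩ := h
    obtain ⟨x, hx0, hx, hxk⟩ := ih v hv
    refine ⟨fun i => Nat.casesOn i x₀ x, rfl, ?_, hxk⟩
    rintro (_ | i) hi
    · simpa [hx0] using hfv
    · exact hx i (by omega)

theorem mem_iterate_of_chain (f g : V →ₗ[K] W) (U : Submodule K W) (k : ℕ) (x : ℕ → V)
    (hx : ∀ i < k, f (x (i + 1)) = g (x i)) (hxk : g (x k) ∈ U) :
    g (x 0) ∈ (relationMap f g)^[k] U := by
  induction k generalizing x with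
  | zero => exact hxk
  | succ k ih =>
    rw [Function.iterate_succ_apply']
    exact ⟨x 1, ih (fun i => x (i + 1)) (fun i hi => hx (i + 1) (by omega)) hxk,
      hx 0 (by omega)⟩

theorem exists_dual_chain (f g : V →ₗ[K] W) (U : Submodule K W) (k : ℕ) (φ : Module.Dual K W)
    (h : φ ∈ ((relationMap f g)^[k] U).dualAnnihilator) :
    ∃ ψ : ℕ → Module.Dual K W, ψ 0 = φ ∧ (∀ i < k, ψ i ∘ₗ f = ψ (i + 1) ∘ₗ g) ∧
      ψ k ∈ U.dualAnnihilator := by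
  induction k generalizing φ with
  | zero => exact ⟨fun _ => φ, rfl, by simp, h⟩
  | succ k ih =>
    rw [Function.iterate_succ_apply'] at h
    set A := (relationMap f g)^[k] U
    have hmem : φ ∘ₗ f ∈ (LinearMap.ker (A.mkQ ∘ₗ g)).dualAnnihilator := by
      rw [Submodule.mem_dualAnnihilator] at h ⊢
      intro v hv
      refine h _ ⟨v, ?_, rfl⟩
      simpa [LinearMap.mem_ker] using hv
    rw [← LinearMap.range_dualMap_eq_dualAnnihilator_ker] at hmem
    obtain ⟨χ, hχ⟩ := hmem
    obtain ⟨ψ, hψ0, hψ, hψk⟩ := ih (χ ∘ₗ A.mkQ) (by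
      rw [Submodule.mem_dualAnnihilator]
      intro w hw
      simp [(Submodule.Quotient.mk_eq_zero A).2 hw])
    refine ⟨fun i => Nat.casesOn i φ ψ, rfl, ?_, hψk⟩
    rintro (_ | i) hi
    · exact hχ.symm.trans (congrArg (· ∘ₗ g) hψ0.symm)
    · exact hψ i (by omega)

theorem linearIndependent_of_chain (f g : V →ₗ[K] W) (k : ℕ) (x : ℕ → V)
    (h0 : f (x 0) = 0) (hg : g (x 0) ≠ 0) (hx : ∀ i < k, f (x (i + 1)) = g (x i))
    (hterm : ∀ (d : ℕ) (y : V), f y = 0 → g y ≠ 0 → g y ∉ (relationMap f g)^[d] ⊥) :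
    LinearIndependent K fun i : Fin (k + 1) => x i := by
  classical
  by_contra hli
  obtain ⟨c, hc, i₀, hi₀⟩ := Fintype.not_linearIndependent_iff.1 hli
  let a : ℕ → K := fun i => if h : i < k + 1 then c ⟨i, h⟩ else 0
  set d := Nat.findGreatest (fun i => a i ≠ 0) k with hd
  have had : a d ≠ 0 :=
    Nat.findGreatest_spec (P := fun i => a i ≠ 0) (m := i₀) (by omega) (by simpa [a, Nat.lt_succ_iff.1 i₀.isLt] using hi₀)
  have hdk : d ≤ k := Nat.findGreatest_le k
  have hsum : ∑ i ∈ Finset.range (d + 1), a i • x i = 0 := by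
    have h1 : ∑ i ∈ Finset.range (k + 1), a i • x i = 0 := by
      rw [Finset.sum_range, ← hc]
      exact Finset.sum_congr rfl fun i _ => by simp [a, Nat.not_lt.2 (Nat.lt_succ_iff.1 i.isLt)]
    rw [← h1]
    refine Finset.sum_subset (by simp; omega) fun i hi hi' => ?_
    have : a i = 0 := by
      have := Nat.findGreatest_is_greatest (P := fun i => a i ≠ 0) (n := k) (k := i)
        (by simp at hi'; omega) (by simp at hi; omega)
      simpa using this
    simp [this]
  let y : ℕ → V := fun j => ∑ i ∈ Finset.range (j + 1), a (d - (j - i)) • x i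
  have hy0 : y 0 = a d • x 0 := by simp [y]
  have hy : ∀ j < d, f (y (j + 1)) = g (y j) := by
    intro j hj
    simp only [y, map_sum, map_smul]
    rw [Finset.sum_range_succ', h0, smul_zero, add_zero]
    refine Finset.sum_congr rfl fun i hi => ?_
    rw [hx i (by simp at hi; omega)]
    congr 3
    omega
  have hyd : y d = 0 := by
    rw [← hsum]
    refine Finset.sum_congr rfl fun i hi => ?_
    congr 2
    simp at hi
    omega
  refine hterm d (y 0) ?_ ?_ (mem_iterate_of_chain f g ⊥ d y hy (by simp [hyd]))
  · simp [hy0, h0]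
  · simpa [hy0, had] using hg

end Chains

section

variable {K : Type*} [Field K] {m n : Type*} [Fintype m] [Fintype n]

/-- The transposed pencil is a sum of two two-sided multiples of the pencil. -/
def TransposeDecomposable (A B : Matrix m n K) : Prop :=
  ∃ P P' Q Q' : Matrix n m K,
    Aᵀ = P * A * Q + P' * A * Q' ∧ Bᵀ = P * B * Q + P' * B * Q'

theorem TransposeDecomposable.transpose {A B : Matrix m n K} (h : TransposeDecomposable A B) :
    TransposeDecomposable Aᵀ Bᵀ := by
  obtain ⟨P, P', Q, Q', hA, hB⟩ := h
  refine ⟨Qᵀ, Q'ᵀ, Pᵀ, P'ᵀ, ?_, ?_⟩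
  · conv_lhs => rw [hA]
    simp [Matrix.mul_assoc]
  · conv_lhs => rw [hB]
    simp [Matrix.mul_assoc]

theorem TransposeDecomposable.of_equivalent {m₀ n₀ : Type*} [Fintype m₀] [Fintype n₀]
    {A B : Matrix m n K} {A₀ B₀ : Matrix m₀ n₀ K} (h : TransposeDecomposable A₀ B₀)
    (E : Matrix m m₀ K) (F : Matrix n₀ n K) (E' : Matrix m₀ m K) (F' : Matrix n n₀ K)
    (hA : A = E * A₀ * F) (hB : B = E * B₀ * F)
    (hA₀ : A₀ = E' * A * F') (hB₀ : B₀ = E' * B * F') : TransposeDecomposable A B := by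
  obtain ⟨P, P', Q, Q', h1, h2⟩ := h
  refine ⟨Fᵀ * P * E', Fᵀ * P' * E', F' * Q * Eᵀ, F' * Q' * Eᵀ, ?_, ?_⟩
  · calc Aᵀ = Fᵀ * A₀ᵀ * Eᵀ := by rw [hA]; simp [Matrix.mul_assoc]
      _ = Fᵀ * (P * (E' * A * F') * Q + P' * (E' * A * F') * Q') * Eᵀ := by rw [h1, ← hA₀]
      _ = _ := by simp only [Matrix.mul_add, Matrix.add_mul, Matrix.mul_assoc]
  · calc Bᵀ = Fᵀ * B₀ᵀ * Eᵀ := by rw [hB]; simp [Matrix.mul_assoc]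
      _ = Fᵀ * (P * (E' * B * F') * Q + P' * (E' * B * F') * Q') * Eᵀ := by rw [h2, ← hB₀]
      _ = _ := by simp only [Matrix.mul_add, Matrix.add_mul, Matrix.mul_assoc]

theorem transpose_add_eq_of_orthogonal {A A₀ A₁ : Matrix m n K} {q₀ q₁ : Matrix m m K}
    {p₀ p₁ : Matrix n n K} {P₀ P₀' Q₀ Q₀' P₁ P₁' Q₁ Q₁' : Matrix n m K}
    (hA : A = A₀ + A₁)
    (h00 : q₀ * A * p₀ = A₀) (h11 : q₁ * A * p₁ = A₁)
    (h01 : q₀ * A * p₁ = 0) (h10 : q₁ * A * p₀ = 0)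
    (e0 : q₀ * A₀ * p₀ = A₀) (e1 : q₁ * A₁ * p₁ = A₁)
    (t0 : A₀ᵀ = P₀ * A₀ * Q₀ + P₀' * A₀ * Q₀') (t1 : A₁ᵀ = P₁ * A₁ * Q₁ + P₁' * A₁ * Q₁') :
    Aᵀ = (p₀ᵀ * P₀ * q₀ + p₁ᵀ * P₁ * q₁) * A * (p₀ * Q₀ * q₀ᵀ + p₁ * Q₁ * q₁ᵀ) +
      (p₀ᵀ * P₀' * q₀ + p₁ᵀ * P₁' * q₁) * A * (p₀ * Q₀' * q₀ᵀ + p₁ * Q₁' * q₁ᵀ) := by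
  have key : ∀ X₀ X₁ Y₀ Y₁ : Matrix n m K,
      (p₀ᵀ * X₀ * q₀ + p₁ᵀ * X₁ * q₁) * A * (p₀ * Y₀ * q₀ᵀ + p₁ * Y₁ * q₁ᵀ) =
        p₀ᵀ * (X₀ * A₀ * Y₀) * q₀ᵀ + p₁ᵀ * (X₁ * A₁ * Y₁) * q₁ᵀ := by
    intro X₀ X₁ Y₀ Y₁
    calc _ = p₀ᵀ * (X₀ * (q₀ * A * p₀) * Y₀) * q₀ᵀ + p₁ᵀ * (X₁ * (q₁ * A * p₁) * Y₁) * q₁ᵀ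
          + (p₀ᵀ * (X₀ * (q₀ * A * p₁) * Y₁) * q₁ᵀ + p₁ᵀ * (X₁ * (q₁ * A * p₀) * Y₀) * q₀ᵀ) := by
            simp only [Matrix.mul_add, Matrix.add_mul, Matrix.mul_assoc]
            abel
      _ = _ := by rw [h00, h11, h01, h10]; simp
  have t0' : A₀ᵀ = p₀ᵀ * A₀ᵀ * q₀ᵀ := by
    conv_lhs => rw [← e0]
    simp [Matrix.mul_assoc]
  have t1' : A₁ᵀ = p₁ᵀ * A₁ᵀ * q₁ᵀ := by
    conv_lhs => rw [← e1]
    simp [Matrix.mul_assoc]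
  rw [key, key, hA, Matrix.transpose_add, t0', t1', t0, t1]
  simp only [Matrix.mul_add, Matrix.add_mul]
  abel

theorem TransposeDecomposable.of_idempotent [DecidableEq m] [DecidableEq n]
    {A B : Matrix m n K} {q : Matrix m m K}
    {p : Matrix n n K} (hp : p * p = p) (hA : q * A = A * p) (hB : q * B = B * p)
    (h₀ : TransposeDecomposable (A * p) (B * p))
    (h₁ : TransposeDecomposable (A - A * p) (B - B * p)) : TransposeDecomposable A B := by
  obtain ⟨P₀, P₀', Q₀, Q₀', a0, b0⟩ := h₀
  obtain ⟨P₁, P₁', Q₁, Q₁', a1, b1⟩ := h₁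
  have aux : ∀ C : Matrix m n K, q * C = C * p → C * p * p = C * p ∧ q * (C * p) = C * p := by
    intro C hC
    have h1 : C * p * p = C * p := by rw [Matrix.mul_assoc, hp]
    exact ⟨h1, by rw [← Matrix.mul_assoc, hC, h1]⟩
  obtain ⟨ha1, ha2⟩ := aux A hA
  obtain ⟨hb1, hb2⟩ := aux B hB
  refine ⟨pᵀ * P₀ * q + (1 - p)ᵀ * P₁ * (1 - q), pᵀ * P₀' * q + (1 - p)ᵀ * P₁' * (1 - q),
    p * Q₀ * qᵀ + (1 - p) * Q₁ * (1 - q)ᵀ, p * Q₀' * qᵀ + (1 - p) * Q₁' * (1 - q)ᵀ,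
    transpose_add_eq_of_orthogonal (A₀ := A * p) (A₁ := A - A * p) ?_ ?_ ?_ ?_ ?_ ?_ ?_ a0 a1,
    transpose_add_eq_of_orthogonal (A₀ := B * p) (A₁ := B - B * p) ?_ ?_ ?_ ?_ ?_ ?_ ?_ b0 b1⟩ <;>
  simp [Matrix.mul_sub, Matrix.sub_mul, hA, hB, ha1, ha2, hb1, hb2]

theorem TransposeDecomposable.rank_kronecker_le {m₁ n₁ : Type*} [Fintype m₁] [Fintype n₁]
    [DecidableEq m₁] [DecidableEq n₁]
    {A B : Matrix m n K} (h : TransposeDecomposable A B) (R₁ R₂ : Matrix m₁ n₁ K) :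
    (R₁ ⊗ₖ Aᵀ + R₂ ⊗ₖ Bᵀ).rank ≤ 2 * (R₁ ⊗ₖ A + R₂ ⊗ₖ B).rank := by
  obtain ⟨P, P', Q, Q', hA, hB⟩ := h
  have key : ∀ X Y : Matrix n m K,
      (1 : Matrix m₁ m₁ K) ⊗ₖ X * (R₁ ⊗ₖ A + R₂ ⊗ₖ B) * (1 : Matrix n₁ n₁ K) ⊗ₖ Y =
        R₁ ⊗ₖ (X * A * Y) + R₂ ⊗ₖ (X * B * Y) := by
    intro X Y
    simp [Matrix.mul_add, Matrix.add_mul, ← Matrix.mul_kronecker_mul]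
  have hle : ∀ X Y : Matrix n m K,
      (R₁ ⊗ₖ (X * A * Y) + R₂ ⊗ₖ (X * B * Y)).rank ≤ (R₁ ⊗ₖ A + R₂ ⊗ₖ B).rank := by
    intro X Y
    rw [← key]
    exact (Matrix.rank_mul_le_left _ _).trans (Matrix.rank_mul_le_right _ _)
  have hsum : R₁ ⊗ₖ Aᵀ + R₂ ⊗ₖ Bᵀ = (R₁ ⊗ₖ (P * A * Q) + R₂ ⊗ₖ (P * B * Q)) +
      (R₁ ⊗ₖ (P' * A * Q') + R₂ ⊗ₖ (P' * B * Q')) := by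
    rw [hA, hB, Matrix.kronecker_add, Matrix.kronecker_add]
    abel
  rw [hsum, two_mul]
  refine le_trans ?_ (add_le_add (hle P Q) (hle P' Q'))
  rw [Matrix.rank, Matrix.mulVecLin_add]
  exact (Submodule.finrank_mono (LinearMap.range_add_le _ _)).trans
    (Submodule.finrank_add_le_finrank_add_finrank _ _)

end

section Split

variable {K : Type*} [Field K]

theorem transposeDecomposable_nilpotent (k : ℕ) :
    TransposeDecomposable (Matrix.of fun i j : Fin k => if (j : ℕ) = i + 1 then (1 : K) else 0)
      1 := by
  let F : Matrix (Fin k) (Fin k) K := Matrix.of fun i j => if j = i.rev then 1 else 0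
  have hF : ∀ (M : Matrix (Fin k) (Fin k) K) (i j : Fin k), (F * M * F) i j = M i.rev j.rev := by
    intro M i j
    have h : ∀ (x y : Fin k), x = y.rev ↔ y = x.rev := fun x y => by
      rw [eq_comm, Fin.rev_eq_iff]
    simp [F, Matrix.mul_apply, h j]
  refine ⟨F, 0, F, 0, ?_, ?_⟩
  · ext i j
    rw [Matrix.zero_mul, Matrix.zero_mul, add_zero, hF]
    simp only [Matrix.transpose_apply, Matrix.of_apply, Fin.val_rev]
    congr 1
    apply propext
    omega
  · ext i j
    rw [Matrix.zero_mul, Matrix.zero_mul, add_zero, hF]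
    simp [Matrix.one_apply, eq_comm]

theorem transposeDecomposable_rectangular (k : ℕ) :
    TransposeDecomposable
      (Matrix.of fun (i : Fin (k + 1)) (j : Fin (k + 2)) => if (j : ℕ) = i + 1 then (1 : K) else 0)
      (Matrix.of fun (i : Fin (k + 1)) (j : Fin (k + 2)) => if (j : ℕ) = i then (1 : K) else 0) := by
  let C : Matrix (Fin (k + 2)) (Fin (k + 1)) K :=
    Matrix.of fun i a => if i = a.rev.castSucc then 1 else 0
  let G : Matrix (Fin (k + 2)) (Fin (k + 1)) K :=
    Matrix.of fun i a => if i = Fin.last _ then (if a = Fin.last _ then 1 else 0) else 0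
  have hC : ∀ (M : Matrix (Fin (k + 1)) (Fin (k + 2)) K) (i : Fin (k + 1)) (b : Fin (k + 1)),
      (C * M * C) i.castSucc b = M i.rev b.rev.castSucc := by
    intro M i b
    have : ∀ x : Fin (k + 1), i = x.rev ↔ x = i.rev := fun x => by
      rw [eq_comm, Fin.rev_eq_iff]
    simp [C, Matrix.mul_apply, this]
  have hC' : ∀ (M : Matrix (Fin (k + 1)) (Fin (k + 2)) K) (b : Fin (k + 1)),
      (C * M * C) (Fin.last _) b = 0 := by
    intro M b
    have : ∀ x : Fin (k + 1), Fin.last (k + 1) ≠ x.castSucc := fun x => (Fin.castSucc_ne_last x).symm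
    simp [C, Matrix.mul_apply, this]
  have hG : ∀ (M : Matrix (Fin (k + 1)) (Fin (k + 2)) K) (i : Fin (k + 2)) (b : Fin (k + 1)),
      (G * M * G) i b = if i = Fin.last _ then
        (if b = Fin.last _ then M (Fin.last _) (Fin.last _) else 0) else 0 := by
    intro M i b
    by_cases h : i = Fin.last _ <;> by_cases h' : b = Fin.last _ <;>
      simp [G, Matrix.mul_apply, h, h']
  refine ⟨C, G, C, G, ?_, ?_⟩
  · ext i b
    rw [Matrix.add_apply, hG]
    induction i using Fin.lastCases with
    | last =>
      rw [hC']
      simp [Fin.ext_iff, eq_comm]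
    | cast i =>
      rw [hC]
      simp only [Matrix.transpose_apply, Matrix.of_apply, Fin.castSucc_ne_last, if_false, add_zero,
        Fin.val_rev, Fin.val_castSucc]
      congr 1
      apply propext
      omega
  · ext i b
    rw [Matrix.add_apply, hG]
    induction i using Fin.lastCases with
    | last =>
      rw [hC']
      have := b.isLt
      simp
      omega
    | cast i =>
      rw [hC]
      simp only [Matrix.transpose_apply, Matrix.of_apply, Fin.castSucc_ne_last, if_false, add_zero,
        Fin.val_rev, Fin.val_castSucc]
      congr 1
      apply propext
      omega

variable {m n : Type*} [Fintype m] [Fintype n]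

/-- The pencil has a nonzero direct summand, cut out by idempotents, which is
`TransposeDecomposable`. -/
def HasDecomposableSummand (A B : Matrix m n K) : Prop :=
  ∃ (q : Matrix m m K) (p : Matrix n n K), q * q = q ∧ p * p = p ∧ q * A = A * p ∧ q * B = B * p ∧
    (A * p ≠ 0 ∨ B * p ≠ 0) ∧ TransposeDecomposable (A * p) (B * p)

theorem HasDecomposableSummand.of_transpose {A B : Matrix m n K}
    (h : HasDecomposableSummand Aᵀ Bᵀ) : HasDecomposableSummand A B := by
  obtain ⟨q, p, hq, hp, hA, hB, hne, hd⟩ := h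
  have hA' : A * qᵀ = pᵀ * A := by simpa using congrArg Matrix.transpose hA
  have hB' : B * qᵀ = pᵀ * B := by simpa using congrArg Matrix.transpose hB
  refine ⟨pᵀ, qᵀ, ?_, ?_, hA'.symm, hB'.symm, ?_, ?_⟩
  · rw [← Matrix.transpose_mul, hp]
  · rw [← Matrix.transpose_mul, hq]
  · rw [hA', hB']
    refine hne.imp (fun h h' => h ?_) (fun h h' => h ?_) <;>
    simpa using congrArg Matrix.transpose h'
  · rw [hA', hB']
    simpa using hd.transpose

theorem HasDecomposableSummand.of_sub_smul {A B : Matrix m n K} (c : K)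
    (h : HasDecomposableSummand (B - c • A) A) : HasDecomposableSummand A B := by
  obtain ⟨q, p, hq, hp, hBA, hA, hne, P, P', Q, Q', h1, h2⟩ := h
  have hB : B = (B - c • A) + c • A := by simp
  refine ⟨q, p, hq, hp, hA, ?_, ?_, P, P', Q, Q', h2, ?_⟩
  · rw [hB, Matrix.mul_add, hBA, Matrix.mul_smul, hA, Matrix.add_mul, Matrix.smul_mul]
  · by_contra! hcon
    obtain ⟨h3, h4⟩ := hcon
    simp [Matrix.sub_mul, h3, h4] at hne
  · have : B * p = (B - c • A) * p + c • (A * p) := by simp [Matrix.sub_mul]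
    rw [this, Matrix.transpose_add, h1, Matrix.transpose_smul, h2]
    simp only [Matrix.mul_add, Matrix.add_mul, Matrix.mul_smul, Matrix.smul_mul, smul_add]
    abel

theorem HasDecomposableSummand.of_retract {m₀ n₀ : Type*} [Fintype m₀] [Fintype n₀]
    [DecidableEq m₀] [DecidableEq n₀] {A B : Matrix m n K} {A₀ B₀ : Matrix m₀ n₀ K}
    (hd : TransposeDecomposable A₀ B₀) (hne : B₀ ≠ 0)
    (i : Matrix n n₀ K) (i' : Matrix m m₀ K) (r : Matrix n₀ n K) (r' : Matrix m₀ m K)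
    (hr : r * i = 1) (hr' : r' * i' = 1) (hAi : A * i = i' * A₀) (hBi : B * i = i' * B₀)
    (hAr : r' * A = A₀ * r) (hBr : r' * B = B₀ * r) : HasDecomposableSummand A B := by
  have hA : A * (i * r) = i' * A₀ * r := by rw [← Matrix.mul_assoc, hAi]
  have hB : B * (i * r) = i' * B₀ * r := by rw [← Matrix.mul_assoc, hBi]
  have key : ∀ M : Matrix m₀ n₀ K, r' * (i' * M * r) * i = M := by
    intro M
    calc _ = (r' * i') * M * (r * i) := by simp only [Matrix.mul_assoc]
      _ = M := by rw [hr, hr', Matrix.one_mul, Matrix.mul_one]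
  refine ⟨i' * r', i * r, ?_, ?_, ?_, ?_, Or.inr fun h => hne ?_, ?_⟩
  · rw [Matrix.mul_assoc, ← Matrix.mul_assoc r', hr', Matrix.one_mul]
  · rw [Matrix.mul_assoc, ← Matrix.mul_assoc r, hr, Matrix.one_mul]
  · rw [hA, Matrix.mul_assoc, hAr, Matrix.mul_assoc]
  · rw [hB, Matrix.mul_assoc, hBr, Matrix.mul_assoc]
  · rw [← key B₀, ← hB, h]
    simp
  · rw [hA, hB]
    exact hd.of_equivalent i' r r' i rfl rfl (key _).symm (key _).symm

theorem exists_dotProduct_eq (φ : Module.Dual K (m → K)) : ∃ y : m → K, ∀ u, y ⬝ᵥ u = φ u := by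
  classical
  refine ⟨fun a => φ (Pi.single a 1), fun u => ?_⟩
  conv_rhs => rw [pi_eq_sum_univ' u]
  simp [dotProduct, mul_comm]

theorem exists_vector_chain {A B : Matrix m n K} {U : Submodule K (m → K)} {k : ℕ} {w : m → K}
    (h : w ∉ (relationMap A.mulVecLin B.mulVecLin)^[k] U) :
    ∃ ψ : ℕ → m → K, ψ 0 ⬝ᵥ w = 1 ∧ (∀ i < k, ψ i ᵥ* A = ψ (i + 1) ᵥ* B) ∧
      ∀ u ∈ U, ψ k ⬝ᵥ u = 0 := by
  classical
  obtain ⟨φ, hφw, hφ⟩ := Submodule.exists_le_ker_of_notMem h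
  obtain ⟨ψ, hψ0, hψ, hψk⟩ := exists_dual_chain A.mulVecLin B.mulVecLin U k ((φ w)⁻¹ • φ) (by
    rw [Submodule.mem_dualAnnihilator]
    intro v hv
    have : φ v = 0 := hφ hv
    simp [this])
  choose vec hvec using fun i => exists_dotProduct_eq (ψ i)
  refine ⟨vec, ?_, ?_, ?_⟩
  · rw [hvec, hψ0]
    simp [hφw]
  · intro i hi
    refine dotProduct_eq _ _ fun v => ?_
    rw [← Matrix.dotProduct_mulVec, ← Matrix.dotProduct_mulVec, hvec, hvec]
    exact LinearMap.congr_fun (hψ i hi) v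
  · intro u hu
    rw [hvec]
    exact (Submodule.mem_dualAnnihilator _).1 hψk u hu

theorem dotProduct_chain_of_le {A B : Matrix m n K} {x : ℕ → n → K} {ψ : ℕ → m → K} {k : ℕ}
    (h0 : A *ᵥ x 0 = 0) (hx : ∀ i < k, A *ᵥ x (i + 1) = B *ᵥ x i)
    (hψ0 : ψ 0 ⬝ᵥ (B *ᵥ x 0) = 1) (hψ : ∀ i < k, ψ i ᵥ* A = ψ (i + 1) ᵥ* B)
    {i j : ℕ} (hi : i ≤ k) (hj : j ≤ i) : ψ i ⬝ᵥ (B *ᵥ x j) = if j = i then 1 else 0 := by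
  induction j generalizing i with
  | zero =>
    cases i with
    | zero => simpa using hψ0
    | succ i =>
      rw [Matrix.dotProduct_mulVec, ← hψ i hi, ← Matrix.dotProduct_mulVec, h0, dotProduct_zero]
      simp
  | succ j ih =>
    cases i with
    | zero => omega
    | succ i =>
      rw [Matrix.dotProduct_mulVec, ← hψ i hi, ← Matrix.dotProduct_mulVec, hx j (by omega),
        ih (by omega) (by omega)]
      simp

theorem hasDecomposableSummand_of_terminating {A B : Matrix m n K} {x₀ : n → K} {k : ℕ}
    (h0 : A *ᵥ x₀ = 0)
    (hk : B *ᵥ x₀ ∈ (relationMap A.mulVecLin B.mulVecLin)^[k + 1] ⊥)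
    (hk' : B *ᵥ x₀ ∉ (relationMap A.mulVecLin B.mulVecLin)^[k] ⊥) :
    HasDecomposableSummand A B := by
  obtain ⟨x, rfl, hx, hxk⟩ := exists_chain_of_mem_iterate _ _ _ _ _ hk
  obtain ⟨ψ, hψ0, hψ, -⟩ := exists_vector_chain hk'
  simp only [Matrix.mulVecLin_apply, Submodule.mem_bot] at hx hxk
  have hup : ∀ d i j, i + d ≤ k → j + d = k + 1 → ψ i ⬝ᵥ (B *ᵥ x j) = 0 := by
    intro d
    induction d with
    | zero =>
      rintro i j - rfl
      simp [hxk]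
    | succ d ih =>
      intro i j hi hj
      rw [← hx j (by omega), Matrix.dotProduct_mulVec, hψ i (by omega), ← Matrix.dotProduct_mulVec]
      exact ih (i + 1) (j + 1) (by omega) (by omega)
  have hdelta : ∀ i ≤ k, ∀ j ≤ k + 1, ψ i ⬝ᵥ (B *ᵥ x j) = if j = i then 1 else 0 := by
    intro i hi j hj
    by_cases hji : j ≤ i
    · exact dotProduct_chain_of_le h0 (fun i hi => hx i (by omega)) hψ0 hψ hi hji
    · rw [if_neg (by omega)]
      exact hup (k + 1 - j) i j (by omega) (by omega)
  refine HasDecomposableSummand.of_retract (transposeDecomposable_rectangular k) ?_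
    (Matrix.of fun a j => x j a) (Matrix.of fun a i => (B *ᵥ x i) a)
    (Matrix.of fun j => Fin.cases (ψ 0 ᵥ* B) (fun i : Fin (k + 1) => ψ i ᵥ* A) j)
    (Matrix.of fun i => ψ i) ?_ ?_ ?_ ?_ ?_ ?_
  · intro h
    simpa using congrFun (congrFun h 0) 0
  · ext i j
    induction i using Fin.cases with
    | zero =>
      change (ψ 0 ᵥ* B) ⬝ᵥ x j = _
      rw [← Matrix.dotProduct_mulVec, hdelta 0 (by omega) j (by omega),
        Matrix.one_apply]
      exact if_congr (by rw [Fin.ext_iff, eq_comm, Fin.val_zero]) rfl rfl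
    | succ i =>
      change (ψ i ᵥ* A) ⬝ᵥ x j = _
      rw [← Matrix.dotProduct_mulVec]
      induction j using Fin.cases with
      | zero => simp [h0]
      | succ j =>
        rw [Fin.val_succ, hx j (by omega), hdelta i (by omega) j (by omega)]
        simp [Matrix.one_apply, Fin.ext_iff, eq_comm]
  · ext i j
    change ψ i ⬝ᵥ (B *ᵥ x j) = _
    rw [hdelta i (by omega) j (by omega)]
    simp [Matrix.one_apply, Fin.ext_iff, eq_comm]
  · ext a j
    change (A *ᵥ x j) a = _
    induction j using Fin.cases with
    | zero => simp [h0, Matrix.mul_apply]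
    | succ j => simp [Matrix.mul_apply, hx j (by omega), ← Fin.ext_iff]
  · ext a j
    change (B *ᵥ x j) a = _
    induction j using Fin.lastCases with
    | last =>
      have : ∀ i : Fin (k + 1), k + 1 ≠ i := fun i => by omega
      simp [hxk, Matrix.mul_apply, this]
    | cast j => simp [Matrix.mul_apply, ← Fin.ext_iff]
  · ext i a
    change (ψ i ᵥ* A) a = _
    have : ∀ j : Fin (k + 2), (j : ℕ) = i + 1 ↔ j = i.succ := fun j => by simp [Fin.ext_iff]
    simp [Matrix.mul_apply, this]
  · ext i a
    change (ψ i ᵥ* B) a = _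
    have : ∀ j : Fin (k + 2), (j : ℕ) = i ↔ j = i.castSucc := fun j => by simp [Fin.ext_iff]
    simp only [Matrix.mul_apply, Matrix.of_apply, this, ite_mul, one_mul, zero_mul,
      Finset.sum_ite_eq', Finset.mem_univ, if_true]
    induction i using Fin.cases with
    | zero => rfl
    | succ i =>
      rw [← Fin.succ_castSucc, Fin.cases_succ, Fin.val_castSucc, hψ i (by omega), Fin.val_succ]

theorem hasDecomposableSummand_of_maximal {A B : Matrix m n K} {x₀ : n → K} {k : ℕ}
    (h0 : A *ᵥ x₀ = 0)
    (hk : B *ᵥ x₀ ∈ (relationMap A.mulVecLin B.mulVecLin)^[k] ⊤)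
    (hk' : B *ᵥ x₀ ∉ (relationMap A.mulVecLin B.mulVecLin)^[k + 1] ⊤) :
    HasDecomposableSummand A B := by
  obtain ⟨x, rfl, hx, -⟩ := exists_chain_of_mem_iterate _ _ _ _ _ hk
  obtain ⟨ψ, hψ0, hψ, hψk⟩ := exists_vector_chain hk'
  simp only [Matrix.mulVecLin_apply] at hx
  have hlast : ψ k ᵥ* A = 0 := by
    rw [hψ k (by omega), dotProduct_eq (ψ (k + 1)) 0 (by simpa using hψk), Matrix.zero_vecMul]
  set N : Matrix (Fin (k + 1)) (Fin (k + 1)) K :=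
    Matrix.of fun i j => if (j : ℕ) = i + 1 then 1 else 0 with hN
  set X : Matrix n (Fin (k + 1)) K := Matrix.of fun a j => x j a with hX
  set Y : Matrix (Fin (k + 1)) m K := Matrix.of fun i => ψ i with hY
  have hAX : A * X = B * X * N := by
    ext a j
    change (A *ᵥ x j) a = ∑ i : Fin (k + 1), (B *ᵥ x i) a * N i j
    induction j using Fin.cases with
    | zero => simp [h0, hN]
    | succ j =>
      have : ∀ i : Fin (k + 1), (j : ℕ) = i ↔ i = j.castSucc := fun i => by
        rw [Fin.ext_iff, Fin.val_castSucc, eq_comm]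
      simp [hN, hx j (by omega), this]
  have hYA : Y * A = N * (Y * B) := by
    ext i a
    change (ψ i ᵥ* A) a = ∑ j : Fin (k + 1), N i j * (ψ j ᵥ* B) a
    induction i using Fin.lastCases with
    | last =>
      have : ∀ j : Fin (k + 1), (j : ℕ) ≠ k + 1 := fun i => by omega
      simp [hlast, hN, this]
    | cast i =>
      have : ∀ j : Fin (k + 1), (j : ℕ) = i + 1 ↔ j = i.succ := fun j => by simp [Fin.ext_iff]
      simp [hN, this, hψ i (by omega)]
  set H := Y * (B * X) with hH
  have hHapply : ∀ i j : Fin (k + 1), j ≤ i → H i j = if j = i then 1 else 0 := by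
    intro i j hji
    change ψ i ⬝ᵥ (B *ᵥ x j) = _
    rw [dotProduct_chain_of_le h0 hx hψ0 (fun i hi => hψ i (by omega)) (by omega) hji]
    simp [Fin.ext_iff]
  have hdet : IsUnit H.det := by
    rw [Matrix.det_of_isUpperTriangular]
    · simp [hHapply]
    · intro i j hji
      exact (hHapply i j (le_of_lt hji)).trans (if_neg (ne_of_lt hji))
  have hcomm : N * H = H * N := by
    calc N * H = Y * A * X := by rw [hYA, hH]; simp only [Matrix.mul_assoc]
      _ = H * N := by rw [Matrix.mul_assoc, hAX, hH]; simp only [Matrix.mul_assoc]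
  have hcomm' : N * H⁻¹ = H⁻¹ * N := by
    calc N * H⁻¹ = H⁻¹ * (H * N) * H⁻¹ := by
          rw [← Matrix.mul_assoc, Matrix.nonsing_inv_mul _ hdet, Matrix.one_mul]
      _ = H⁻¹ * N := by
          rw [← hcomm, Matrix.mul_assoc, Matrix.mul_assoc, Matrix.mul_nonsing_inv _ hdet,
            Matrix.mul_one]
  refine HasDecomposableSummand.of_retract (transposeDecomposable_nilpotent (k + 1)) one_ne_zero
    (X * H⁻¹) (B * X * H⁻¹) (Y * B) Y ?_ ?_ ?_ ?_ ?_ ?_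
  · rw [← Matrix.mul_assoc, Matrix.mul_assoc Y, ← hH, Matrix.mul_nonsing_inv _ hdet]
  · rw [← Matrix.mul_assoc, ← hH, Matrix.mul_nonsing_inv _ hdet]
  · rw [← Matrix.mul_assoc, hAX, Matrix.mul_assoc, ← hN, hcomm', Matrix.mul_assoc, Matrix.mul_assoc]
    simp only [Matrix.mul_assoc]
  · rw [Matrix.mul_one, Matrix.mul_assoc]
  · exact hYA
  · rw [Matrix.one_mul]

theorem hasDecomposableSummand_of_ker {A B : Matrix m n K} {x₀ : n → K}
    (h0 : A *ᵥ x₀ = 0) (hB : B *ᵥ x₀ ≠ 0) : HasDecomposableSummand A B := by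
  classical
  by_cases hterm : ∃ (d : ℕ) (y : n → K), A *ᵥ y = 0 ∧ B *ᵥ y ≠ 0 ∧
      B *ᵥ y ∈ (relationMap A.mulVecLin B.mulVecLin)^[d] ⊥
  · obtain ⟨y, hy, hBy, hyd⟩ := Nat.find_spec hterm
    rcases hd : Nat.find hterm with _ | d
    · rw [hd] at hyd
      exact absurd hyd hBy
    · rw [hd] at hyd
      exact hasDecomposableSummand_of_terminating hy hyd fun h =>
        Nat.find_min hterm (m := d) (by omega) ⟨y, hy, hBy, h⟩
  · push Not at hterm
    by_contra hno
    have hall : ∀ k, B *ᵥ x₀ ∈ (relationMap A.mulVecLin B.mulVecLin)^[k] ⊤ := by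
      intro k
      induction k with
      | zero => trivial
      | succ k ih =>
        by_contra hk
        exact hno (hasDecomposableSummand_of_maximal h0 ih hk)
    obtain ⟨x, rfl, hx, -⟩ := exists_chain_of_mem_iterate _ _ _ _ _ (hall (Fintype.card n))
    have hli := linearIndependent_of_chain A.mulVecLin B.mulVecLin (Fintype.card n) x h0 hB hx hterm
    simpa using hli.fintype_card_le_finrank

theorem hasDecomposableSummand [IsAlgClosed K] {A B : Matrix m n K} (hne : A ≠ 0 ∨ B ≠ 0) :
    HasDecomposableSummand A B := by
  classical
  by_contra hno
  have hleft : ∀ y : m → K, y ᵥ* A = 0 → y ᵥ* B = 0 := by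
    intro y hy
    by_contra hyB
    rw [← Matrix.mulVec_transpose] at hy hyB
    exact hno (hasDecomposableSummand_of_ker hy hyB).of_transpose
  have hright : ∀ (c : K) (x : n → K), B *ᵥ x = c • A *ᵥ x → A *ᵥ x = 0 := by
    intro c x hx
    by_contra hxA
    refine hno (HasDecomposableSummand.of_sub_smul c (hasDecomposableSummand_of_ker ?_ hxA))
    rw [Matrix.sub_mulVec, Matrix.smul_mulVec, hx, sub_self]
  have hrange : LinearMap.range B.mulVecLin ≤ LinearMap.range A.mulVecLin := by
    rintro _ ⟨x, rfl⟩
    by_contra hx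
    obtain ⟨φ, hφ, hle⟩ := Submodule.exists_le_ker_of_notMem hx
    obtain ⟨y, hy⟩ := exists_dotProduct_eq φ
    have hyA : y ᵥ* A = 0 := by
      refine dotProduct_eq _ _ fun v => ?_
      rw [← Matrix.dotProduct_mulVec, hy, zero_dotProduct]
      exact hle ⟨v, rfl⟩
    apply hφ
    rw [← hy, Matrix.mulVecLin_apply, Matrix.dotProduct_mulVec, hleft y hyA, zero_dotProduct]
  have hA : A ≠ 0 := by
    rintro rfl
    refine hne.elim (fun h => h rfl) fun h => h ?_
    refine Matrix.mulVec_injective (funext fun v => ?_)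
    obtain ⟨w, hw⟩ := hrange ⟨v, rfl⟩
    simpa using hw.symm
  obtain ⟨s, hs⟩ := A.mulVecLin.rangeRestrict.exists_rightInverse_of_surjective
    (LinearMap.range_rangeRestrict _)
  have : Nontrivial (LinearMap.range A.mulVecLin) := by
    rw [Submodule.nontrivial_iff_ne_bot, Ne, LinearMap.range_eq_bot]
    intro h
    exact hA (Matrix.mulVec_injective (funext fun v => by simpa using LinearMap.congr_fun h v))
  let T : Module.End K (LinearMap.range A.mulVecLin) :=
    (B.mulVecLin.codRestrict (LinearMap.range A.mulVecLin) fun x => hrange ⟨x, rfl⟩) ∘ₗ s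
  obtain ⟨c, hc⟩ := Module.End.exists_eigenvalue T
  obtain ⟨u, hu⟩ := hc.exists_hasEigenvector
  have hAu : A *ᵥ s u = u := congrArg Subtype.val (LinearMap.congr_fun hs u)
  have hBu : B *ᵥ s u = c • (u : m → K) := congrArg Subtype.val hu.apply_eq_smul
  refine hu.2 (Subtype.ext ?_)
  rw [← hAu]
  exact hright c (s u) (by rw [hBu, hAu])

theorem rank_sub_mul_le [DecidableEq m] {C : Matrix m n K} {q : Matrix m m K} {p : Matrix n n K}
    (hC : q * C = C * p) : (C - C * p).rank ≤ C.rank := by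
  have : C - C * p = (1 - q) * C := by rw [Matrix.sub_mul, hC, Matrix.one_mul]
  rw [this]
  exact Matrix.rank_mul_le_right _ _

theorem rank_sub_mul_lt {C : Matrix m n K} {q : Matrix m m K} {p : Matrix n n K}
    (hp : p * p = p) (hC : q * C = C * p) (hne : C * p ≠ 0) : (C - C * p).rank < C.rank := by
  classical
  have hqC : q * (C - C * p) = 0 := by
    rw [Matrix.mul_sub, ← Matrix.mul_assoc, hC, Matrix.mul_assoc, hp, sub_self]
  refine Submodule.finrank_lt_finrank_of_lt (lt_of_le_of_ne ?_ fun h => hne ?_)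
  · have : C - C * p = C * (1 - p) := by rw [Matrix.mul_sub, Matrix.mul_one]
    rw [this, Matrix.mulVecLin_mul]
    exact LinearMap.range_comp_le_range _ _
  · rw [← hC]
    refine Matrix.mulVec_injective (funext fun v => ?_)
    obtain ⟨w, hw⟩ : C *ᵥ v ∈ LinearMap.range (C - C * p).mulVecLin := h ▸ ⟨v, rfl⟩
    rw [Matrix.mulVecLin_apply] at hw
    rw [← Matrix.mulVec_mulVec, ← hw, Matrix.mulVec_mulVec, hqC]
    simp

theorem transposeDecomposable [IsAlgClosed K] (A B : Matrix m n K) :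
    TransposeDecomposable A B := by
  classical
  induction hN : A.rank + B.rank using Nat.strong_induction_on generalizing A B with
  | _ N ih =>
  by_cases hne : A ≠ 0 ∨ B ≠ 0
  · obtain ⟨q, p, -, hp, hA, hB, hnz, hd⟩ := hasDecomposableSummand hne
    refine TransposeDecomposable.of_idempotent hp hA hB hd (ih _ ?_ _ _ rfl)
    rw [← hN]
    rcases hnz with h | h
    · exact add_lt_add_of_lt_of_le (rank_sub_mul_lt hp hA h) (rank_sub_mul_le hB)
    · exact add_lt_add_of_le_of_lt (rank_sub_mul_le hA) (rank_sub_mul_lt hp hB h)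
  · push Not at hne
    obtain ⟨rfl, rfl⟩ := hne
    exact ⟨0, 0, 0, 0, by simp, by simp⟩

end Split

theorem stmt_16 (m₁ n₁ m₂ n₂ : ℕ)
    (R₁ R₂ : Matrix (Fin m₁) (Fin n₁) ℂ)
    (S₁ S₂ : Matrix (Fin m₂) (Fin n₂) ℂ) :
    (R₁ ⊗ₖ S₁ᵀ + R₂ ⊗ₖ S₂ᵀ).rank ≤ 2 * (R₁ ⊗ₖ S₁ + R₂ ⊗ₖ S₂).rank :=
  (transposeDecomposable S₁ S₂).rank_kronecker_le R₁ R₂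
end

section
/- Let U = ∑_{i=1}^{3} R_i ⊗ S_i be a unitary matrix on ℂ^3 ⊗ ℂ^{d} where R_i are 3×3 and S_i are d×d matrices. Then rank(∑_{i=1}^{3} R_i ⊗ S_iᵀ) = rank(U) = 3d; in particular rank(∑_{i=1}^{3} R_i ⊗ S_iᵀ) ≤ 3 · rank(U). -/
open Matrix Kronecker Finset
open Module

/-- The blocks `u a b` of an operator from `ℂ³ ⊗ H` to `ℂ³ ⊗ K` that is an isometry between spaces
of equal dimension and has operator Schmidt rank at most three. -/
structure IsRankThreeUnitary {H K : Type} [NormedAddCommGroup H] [InnerProductSpace ℂ H]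
    [NormedAddCommGroup K] [InnerProductSpace ℂ K] (u : Fin 3 → Fin 3 → H →ₗ[ℂ] K) : Prop where
  inner_columns : ∀ b c x y, ∑ a, inner ℂ (u a b x) (u a c y) = if b = c then inner ℂ x y else 0
  finrank_eq : finrank ℂ H = finrank ℂ K
  expansion : ∃ (r : Fin 3 → Matrix (Fin 3) (Fin 3) ℂ) (s : Fin 3 → H →ₗ[ℂ] K),
    ∀ a b, u a b = ∑ i, r i a b • s i

/-- The operator obtained from `u` by transposing its array of blocks is injective. -/
def TransposeInjective {H K : Type} [AddCommGroup H] [Module ℂ H] [AddCommGroup K] [Module ℂ K]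
    (u : Fin 3 → Fin 3 → H →ₗ[ℂ] K) : Prop :=
  ∀ x : Fin 3 → H, (∀ a, ∑ b, u b a (x b) = 0) → x = 0

/-- The inductive hypothesis: block transposes are injective in all dimensions below `d`. -/
def TransposeInjectiveBelow (d : ℕ) : Prop :=
  ∀ (H K : Type) [NormedAddCommGroup H] [InnerProductSpace ℂ H] [FiniteDimensional ℂ H]
    [NormedAddCommGroup K] [InnerProductSpace ℂ K] [FiniteDimensional ℂ K]
    (u : Fin 3 → Fin 3 → H →ₗ[ℂ] K), finrank ℂ H < d → IsRankThreeUnitary u → TransposeInjective u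

section LinearAlgebra

variable {V W : Type*} [AddCommGroup V] [Module ℂ V] [AddCommGroup W] [Module ℂ W]

theorem exists_pencil_kernel [FiniteDimensional ℂ V] [FiniteDimensional ℂ W] [Nontrivial V]
    (h : finrank ℂ V = finrank ℂ W) (f g : V →ₗ[ℂ] W) :
    ∃ c d : ℂ, (c ≠ 0 ∨ d ≠ 0) ∧ ∃ v ≠ 0, c • f v + d • g v = 0 := by
  by_cases hg : Function.Injective g
  · let e := LinearMap.linearEquivOfInjective g hg h
    obtain ⟨μ, hμ⟩ := Module.End.exists_eigenvalue (e.symm.toLinearMap ∘ₗ f : Module.End ℂ V)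
    obtain ⟨v, hv⟩ := hμ.exists_hasEigenvector
    refine ⟨1, -μ, Or.inl one_ne_zero, v, hv.2, ?_⟩
    have h1 : e.symm (f v) = μ • v := hv.apply_eq_smul
    have h2 : f v = e (μ • v) := by rw [← h1, e.apply_symm_apply]
    have h3 : e (μ • v) = μ • g v := by rw [map_smul]; rfl
    rw [h2, h3]; simp
  · rw [← LinearMap.ker_eq_bot, Submodule.eq_bot_iff] at hg
    push Not at hg
    obtain ⟨v, hv, hv0⟩ := hg
    exact ⟨0, 1, Or.inr one_ne_zero, v, hv0, by simpa using hv⟩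

theorem exists_relation_or_span_le (s t : Fin 3 → V)
    (ht : ∀ k, t k ∈ Submodule.span ℂ (Set.range s)) :
    (∃ c : Fin 3 → ℂ, c ≠ 0 ∧ ∑ k, c k • t k = 0) ∨
      ∀ x ∈ Submodule.span ℂ (Set.range s), ∃ c : Fin 3 → ℂ, ∑ k, c k • t k = x := by
  by_cases hli : LinearIndependent ℂ t
  · right
    intro x hx
    have : FiniteDimensional ℂ (Submodule.span ℂ (Set.range s)) :=
      FiniteDimensional.span_of_finite ℂ (Set.finite_range s)
    have hle : Submodule.span ℂ (Set.range t) ≤ Submodule.span ℂ (Set.range s) := by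
      rw [Submodule.span_le]; rintro _ ⟨k, rfl⟩; exact ht k
    have : Submodule.span ℂ (Set.range t) = Submodule.span ℂ (Set.range s) := by
      apply Submodule.eq_of_le_of_finrank_le hle
      rw [finrank_span_eq_card hli]
      exact finrank_range_le_card s
    rw [← this] at hx
    exact Submodule.mem_span_range_iff_exists_fun ℂ |>.1 hx
  · left
    rw [Fintype.linearIndependent_iff] at hli
    push Not at hli
    obtain ⟨g, hg, i, hi⟩ := hli
    exact ⟨g, fun h => hi (by simp [h]), hg⟩

theorem exists_proportional_of_mul_eq_mul {p q m n : ℂ} (hne : ¬(p = 0 ∧ q = 0 ∧ m = 0 ∧ n = 0))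
    {x y : V} (hx : m • x = p • y) (hy : n • x = q • y) :
    (x = 0 ∧ y = 0) ∨ ∃ c d : ℂ, (c ≠ 0 ∨ d ≠ 0) ∧ ∃ z : V, x = c • z ∧ y = d • z ∧
      ∃ k l : ℂ, (k ≠ 0 ∨ l ≠ 0) ∧ p = c * k ∧ q = c * l ∧ m = d * k ∧ n = d * l := by
  by_cases hdet : p * n - q * m = 0
  · right
    by_cases hp : p = 0
    · by_cases hm : m = 0
      · subst hp hm
        have hqn : q ≠ 0 ∨ n ≠ 0 := by
          by_contra! h; exact hne ⟨rfl, h.1, rfl, h.2⟩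
        rcases hqn with hq | hn
        · refine ⟨q, n, Or.inl hq, q⁻¹ • x, by simp [hq], ?_, 0, 1, by simp, by simp⟩
          rw [smul_comm, hy, smul_smul, inv_mul_cancel₀ hq, one_smul]
        · refine ⟨q, n, Or.inr hn, n⁻¹ • y, ?_, by simp [hn], 0, 1, by simp, by simp⟩
          rw [smul_comm, ← hy, smul_smul, inv_mul_cancel₀ hn, one_smul]
      · have hx0 : x = 0 := by simpa [hp, hm] using hx
        have hq : q = 0 := by simpa [hp, hm] using hdet
        exact ⟨p, m, Or.inr hm, m⁻¹ • y, by simp [hp, hx0], by simp [hm], 1, n / m, by simp,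
          by simp, by simp [hp, hq], by simp, by field_simp⟩
    · refine ⟨p, m, Or.inl hp, p⁻¹ • x, by simp [hp], ?_, 1, q / p, by simp, by simp,
        by field_simp, by simp, ?_⟩
      · rw [smul_comm, hx, smul_smul, inv_mul_cancel₀ hp, one_smul]
      · field_simp; linear_combination hdet
  · left
    have h1 : (p * n - q * m) • x = 0 := by
      rw [sub_smul, mul_smul, mul_smul, hx, hy, smul_smul, smul_smul, mul_comm, sub_self]
    have h2 : (p * n - q * m) • y = 0 := by
      have e1 : n • m • x = n • p • y := by rw [hx]
      have e2 : m • n • x = m • q • y := by rw [hy]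
      rw [smul_comm, e2] at e1
      simp only [smul_smul] at e1
      rw [sub_smul, mul_comm p, ← e1, mul_comm q, sub_self]
    exact ⟨(smul_eq_zero.1 h1).resolve_left hdet, (smul_eq_zero.1 h2).resolve_left hdet⟩

/-- Any bijective two-by-two array of maps spanning at most three dimensions has an injective
block transpose. -/
theorem two_block_transpose_injective [FiniteDimensional ℂ V] [FiniteDimensional ℂ W]
    (h : finrank ℂ V = finrank ℂ W) (u : Fin 2 → Fin 2 → V →ₗ[ℂ] W)
    (r : Fin 3 → Fin 2 → Fin 2 → ℂ) (s : Fin 3 → V →ₗ[ℂ] W)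
    (hu : ∀ a b, u a b = ∑ i, r i a b • s i)
    (hinj : ∀ x y, u 0 0 x + u 0 1 y = 0 → u 1 0 x + u 1 1 y = 0 → x = 0 ∧ y = 0)
    (hsurj : ∀ z w, ∃ x y, u 0 0 x + u 0 1 y = z ∧ u 1 0 x + u 1 1 y = w)
    {x y : V} (h0 : u 0 0 x + u 1 0 y = 0) (h1 : u 0 1 x + u 1 1 y = 0) : x = 0 ∧ y = 0 := by
  obtain ⟨p, q, m, n, hne, hrel⟩ : ∃ p q m n : ℂ, ¬(p = 0 ∧ q = 0 ∧ m = 0 ∧ n = 0) ∧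
      p • u 0 0 + q • u 0 1 + m • u 1 0 + n • u 1 1 = 0 := by
    let φ : (Fin 2 × Fin 2 → ℂ) →ₗ[ℂ] (Fin 3 → ℂ) :=
      LinearMap.pi fun i => ∑ ab : Fin 2 × Fin 2, r i ab.1 ab.2 • LinearMap.proj ab
    have hker : φ.ker ≠ ⊥ := LinearMap.ker_ne_bot_of_finrank_lt (by simp)
    obtain ⟨l, hl, hl0⟩ := Submodule.exists_mem_ne_zero_of_ne_bot hker
    refine ⟨l (0, 0), l (0, 1), l (1, 0), l (1, 1), ?_, ?_⟩
    · rintro ⟨a, b, c, d⟩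
      apply hl0
      ext ⟨i, j⟩
      fin_cases i <;> fin_cases j <;> simpa
    · have hi : ∀ i, r i 0 0 * l (0, 0) + r i 0 1 * l (0, 1) + (r i 1 0 * l (1, 0)
          + r i 1 1 * l (1, 1)) = 0 := by
        intro i
        have := congrFun (LinearMap.mem_ker.1 hl) i
        simpa [φ, Fintype.sum_prod_type, Fin.sum_univ_two] using this
      simp only [hu, Finset.smul_sum, smul_smul, ← Finset.sum_add_distrib, ← add_smul]
      refine Finset.sum_eq_zero fun i _ => ?_
      rw [show l (0, 0) * r i 0 0 + l (0, 1) * r i 0 1 + l (1, 0) * r i 1 0 + l (1, 1) * r i 1 1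
        = 0 by linear_combination hi i, zero_smul]
  have hrel' : ∀ z, p • u 0 0 z + q • u 0 1 z + m • u 1 0 z + n • u 1 1 z = 0 := fun z => by
    simpa using LinearMap.congr_fun hrel z
  obtain ⟨hx, hy⟩ := hinj (m • x - p • y) (n • x - q • y)
    (by
      simp only [map_sub, map_smul]
      linear_combination (norm := module) m • h0 + n • h1 - hrel' y)
    (by
      simp only [map_sub, map_smul]
      linear_combination (norm := module) hrel' x - p • h0 - q • h1)
  rcases exists_proportional_of_mul_eq_mul hne (sub_eq_zero.1 hx) (sub_eq_zero.1 hy) with hxy |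
    ⟨c, d, hcd, z, rfl, rfl, k, l, hkl, rfl, rfl, rfl, rfl⟩
  · exact hxy
  set f : V →ₗ[ℂ] W := c • u 0 0 + d • u 1 0 with hf
  set g : V →ₗ[ℂ] W := c • u 0 1 + d • u 1 1 with hg
  have hfg : ∀ z, k • f z + l • g z = 0 := fun z => by
    have := hrel' z
    simp only [hf, hg, LinearMap.add_apply, LinearMap.smul_apply]
    linear_combination (norm := module) this
  have hfz : f z = 0 := by simpa [hf] using h0
  have hgz : g z = 0 := by simpa [hg] using h1
  have hfgs : ∀ w, ∃ x y, f x + g y = w := by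
    intro w
    have : ∃ w₀ w₁ : W, c • w₀ + d • w₁ = w := by
      rcases hcd with hc | hd
      · exact ⟨c⁻¹ • w, 0, by simp [hc]⟩
      · exact ⟨0, d⁻¹ • w, by simp [hd]⟩
    obtain ⟨w₀, w₁, rfl⟩ := this
    obtain ⟨x, y, rfl, rfl⟩ := hsurj w₀ w₁
    refine ⟨x, y, ?_⟩
    simp only [hf, hg, LinearMap.add_apply, LinearMap.smul_apply]
    module
  have hz : z = 0 := by
    rcases hkl with hk | hl
    · have hsur : Function.Surjective g := by
        intro w
        obtain ⟨x, y, rfl⟩ := hfgs w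
        refine ⟨y - (l / k) • x, ?_⟩
        have : f x = -(l / k) • g x := by
          rw [← inv_smul_smul₀ hk (f x), eq_neg_of_add_eq_zero_left (hfg x), smul_neg, smul_smul,
            neg_smul, div_eq_inv_mul]
        rw [this, map_sub, map_smul]; module
      exact (LinearMap.injective_iff_surjective_of_finrank_eq_finrank h).2 hsur (by simp [hgz])
    · have hsur : Function.Surjective f := by
        intro w
        obtain ⟨x, y, rfl⟩ := hfgs w
        refine ⟨x - (k / l) • y, ?_⟩
        have : g y = -(k / l) • f y := by
          rw [← inv_smul_smul₀ hl (g y), eq_neg_of_add_eq_zero_right (hfg y), smul_neg, smul_smul,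
            neg_smul, div_eq_inv_mul]
        rw [this, map_sub, map_smul]; module
      exact (LinearMap.injective_iff_surjective_of_finrank_eq_finrank h).2 hsur (by simp [hfz])
  simp [hz]

end LinearAlgebra

section Blocks

variable {H K : Type} [NormedAddCommGroup H] [InnerProductSpace ℂ H] [FiniteDimensional ℂ H]
  [NormedAddCommGroup K] [InnerProductSpace ℂ K] [FiniteDimensional ℂ K]
  {u : Fin 3 → Fin 3 → H →ₗ[ℂ] K}

/-- The operator on triples of vectors with blocks `u a b`. -/
def blockMap (u : Fin 3 → Fin 3 → H →ₗ[ℂ] K) : (Fin 3 → H) →ₗ[ℂ] (Fin 3 → K) :=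
  LinearMap.pi fun a => ∑ b, u a b ∘ₗ LinearMap.proj b

omit [FiniteDimensional ℂ H] [FiniteDimensional ℂ K] in
theorem blockMap_apply (x : Fin 3 → H) (a : Fin 3) : blockMap u x a = ∑ b, u a b (x b) := by
  simp [blockMap]

omit [FiniteDimensional ℂ H] [FiniteDimensional ℂ K] in
theorem transposeInjective_iff :
    TransposeInjective u ↔ Function.Injective (blockMap fun a b => u b a) := by
  rw [← LinearMap.ker_eq_bot, LinearMap.ker_eq_bot']
  simp only [TransposeInjective, funext_iff, blockMap_apply, Pi.zero_apply]

namespace IsRankThreeUnitary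

theorem sum_adjoint_apply (hu : IsRankThreeUnitary u) (b c : Fin 3) (y : H) :
    ∑ a, LinearMap.adjoint (u a b) (u a c y) = if b = c then y else 0 := by
  refine ext_inner_left ℂ fun x => ?_
  rw [inner_sum]
  simp only [LinearMap.adjoint_inner_right, hu.inner_columns]
  split_ifs <;> simp

theorem finrank_pi_eq (hu : IsRankThreeUnitary u) :
    finrank ℂ (Fin 3 → H) = finrank ℂ (Fin 3 → K) := by
  simp [Module.finrank_pi_fintype, hu.finrank_eq]

theorem blockMap_adjoint_blockMap (hu : IsRankThreeUnitary u) (x : Fin 3 → H) :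
    blockMap (fun b a => LinearMap.adjoint (u a b)) (blockMap u x) = x := by
  ext b
  simp only [blockMap_apply, map_sum]
  rw [Finset.sum_comm]
  simp [hu.sum_adjoint_apply]

theorem blockMap_bijective (hu : IsRankThreeUnitary u) : Function.Bijective (blockMap u) := by
  have : Function.Injective (blockMap u) :=
    Function.LeftInverse.injective hu.blockMap_adjoint_blockMap
  exact ⟨this, (LinearMap.injective_iff_surjective_of_finrank_eq_finrank hu.finrank_pi_eq).1 this⟩

theorem blockMap_blockMap_adjoint (hu : IsRankThreeUnitary u) (k : Fin 3 → K) :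
    blockMap u (blockMap (fun b a => LinearMap.adjoint (u a b)) k) = k := by
  obtain ⟨x, rfl⟩ := hu.blockMap_bijective.2 k
  rw [hu.blockMap_adjoint_blockMap]

theorem sum_apply_adjoint (hu : IsRankThreeUnitary u) (a c : Fin 3) (k : K) :
    ∑ b, u a b (LinearMap.adjoint (u c b) k) = if a = c then k else 0 := by
  have := congrFun (hu.blockMap_blockMap_adjoint (Pi.single c k)) a
  have hb : ∀ b, blockMap (fun b a => LinearMap.adjoint (u a b)) (Pi.single c k) b
      = LinearMap.adjoint (u c b) k := fun b => by
    rw [blockMap_apply, Finset.sum_eq_single c (fun a _ ha => by simp [ha]) (by simp)]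
    simp
  simpa only [blockMap_apply (u := u), hb, Pi.single_apply] using this

theorem eq_zero_of_forall_sum_eq_zero (hu : IsRankThreeUnitary u) {x : Fin 3 → H}
    (hx : ∀ a, ∑ b, u a b (x b) = 0) : x = 0 := by
  apply hu.blockMap_bijective.1
  ext a
  rw [blockMap_apply, hx, map_zero, Pi.zero_apply]

theorem adjoint (hu : IsRankThreeUnitary u) :
    IsRankThreeUnitary fun b a => LinearMap.adjoint (u a b) where
  inner_columns a c x y := by
    simp only [LinearMap.adjoint_inner_left]
    rw [← inner_sum, hu.sum_apply_adjoint]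
    split_ifs <;> simp
  finrank_eq := hu.finrank_eq.symm
  expansion := by
    obtain ⟨r, s, h⟩ := hu.expansion
    exact ⟨fun i => (r i).conjTranspose, fun i => LinearMap.adjoint (s i), fun a b => by
      simp only [h, map_sum, LinearEquiv.map_smulₛₗ, Matrix.conjTranspose_apply]; rfl⟩

theorem transposeInjective_of_adjoint (hu : IsRankThreeUnitary u)
    (h : TransposeInjective fun b a => LinearMap.adjoint (u a b)) : TransposeInjective u := by
  intro x hx
  have hs := (LinearMap.injective_iff_surjective_of_finrank_eq_finrank hu.finrank_pi_eq.symm).1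
    (transposeInjective_iff.1 h)
  obtain ⟨y, hy⟩ := hs x
  have : ∑ b, inner ℂ (x b) (x b) = 0 := by
    conv_lhs => enter [2, b, 2]; rw [← hy]
    simp only [blockMap_apply, sum_inner, LinearMap.adjoint_inner_left]
    rw [Finset.sum_comm]
    refine Finset.sum_eq_zero fun a _ => ?_
    rw [← inner_sum, hx, inner_zero_right]
  have h0 : ∑ b, ‖x b‖ ^ 2 = 0 := by
    simp only [inner_self_eq_norm_sq_to_K] at this
    rw [← Complex.ofReal_inj]
    simpa using this
  rw [Finset.sum_eq_zero_iff_of_nonneg fun _ _ => by positivity] at h0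
  ext b
  simpa using h0 b (Finset.mem_univ b)

end IsRankThreeUnitary

theorem sum_star_mul_of_mem_unitaryGroup {P : Matrix (Fin 3) (Fin 3) ℂ}
    (hP : P ∈ Matrix.unitaryGroup (Fin 3) ℂ) (c d : Fin 3) :
    ∑ a, star (P a c) * P a d = if c = d then 1 else 0 := by
  have := congrFun (congrFun (Matrix.mem_unitaryGroup_iff'.1 hP) c) d
  rwa [Matrix.mul_apply, Matrix.one_apply] at this

omit [FiniteDimensional ℂ K] in
theorem sum_inner_of_mem_unitaryGroup {P : Matrix (Fin 3) (Fin 3) ℂ}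
    (hP : P ∈ Matrix.unitaryGroup (Fin 3) ℂ) (v w : Fin 3 → K) :
    ∑ a, inner ℂ (∑ c, P a c • v c) (∑ d, P a d • w d) = ∑ c, inner ℂ (v c) (w c) := by
  simp only [sum_inner, inner_smul_left]
  rw [Finset.sum_comm]
  refine Finset.sum_congr rfl fun c _ => ?_
  simp only [inner_sum, inner_smul_right, Finset.mul_sum]
  rw [Finset.sum_comm]
  have : ∀ d, ∑ a, (starRingEnd ℂ) (P a c) * (P a d * inner ℂ (v c) (w d))
      = if c = d then inner ℂ (v c) (w d) else 0 := fun d => by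
    simp only [← mul_assoc, ← Finset.sum_mul]
    rw [show ∑ a, (starRingEnd ℂ) (P a c) * P a d = _ from sum_star_mul_of_mem_unitaryGroup hP c d]
    split_ifs <;> simp
  rw [← Finset.sum_congr rfl fun d _ => (this d).symm]
  simp

namespace IsRankThreeUnitary

omit [FiniteDimensional ℂ H] [FiniteDimensional ℂ K] in
theorem rotateRows (hu : IsRankThreeUnitary u) {P : Matrix (Fin 3) (Fin 3) ℂ}
    (hP : P ∈ Matrix.unitaryGroup (Fin 3) ℂ) :
    IsRankThreeUnitary fun a b => ∑ c, P a c • u c b where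
  inner_columns b c x y := by
    simp only [LinearMap.sum_apply, LinearMap.smul_apply]
    rw [sum_inner_of_mem_unitaryGroup hP (fun a => u a b x) fun a => u a c y]
    exact hu.inner_columns b c x y
  finrank_eq := hu.finrank_eq
  expansion := by
    obtain ⟨r, s, h⟩ := hu.expansion
    refine ⟨fun i => P * r i, s, fun a b => ?_⟩
    simp only [h, Finset.smul_sum, Matrix.mul_apply, Finset.sum_smul, smul_smul]
    rw [Finset.sum_comm]

theorem rotateCols (hu : IsRankThreeUnitary u) {P : Matrix (Fin 3) (Fin 3) ℂ}
    (hP : P ∈ Matrix.unitaryGroup (Fin 3) ℂ) :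
    IsRankThreeUnitary fun a b => ∑ c, P c b • u a c := by
  have := (hu.adjoint.rotateRows (Unitary.star_mem hP)).adjoint
  simpa only [map_sum, LinearEquiv.map_smulₛₗ, Matrix.star_apply, LinearMap.adjoint_adjoint,
    starRingEnd_apply, star_star] using this

end IsRankThreeUnitary

omit [FiniteDimensional ℂ H] [FiniteDimensional ℂ K] in
theorem transposeInjective_of_rotateRows {P : Matrix (Fin 3) (Fin 3) ℂ}
    (hP : P ∈ Matrix.unitaryGroup (Fin 3) ℂ)
    (h : TransposeInjective fun a b => ∑ c, P a c • u c b) : TransposeInjective u := by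
  intro x hx
  have hinv : ∀ c, ∑ b, P b c • ∑ d, star (P b d) • x d = x c := fun c => by
    simp only [Finset.smul_sum, smul_smul]
    rw [Finset.sum_comm]
    simp only [← Finset.sum_smul]
    have : ∀ d, ∑ b, P b c * star (P b d) = if d = c then 1 else 0 := fun d => by
      rw [← sum_star_mul_of_mem_unitaryGroup hP d c]
      exact Finset.sum_congr rfl fun _ _ => mul_comm _ _
    simp only [this, ite_smul, one_smul, zero_smul, Finset.sum_ite_eq', Finset.mem_univ, if_true]
  have h0 := h (fun b => ∑ d, star (P b d) • x d) fun a => by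
    simp only [LinearMap.sum_apply, LinearMap.smul_apply, ← map_smul]
    rw [Finset.sum_comm]
    simp only [← map_sum, hinv, hx]
  ext c
  rw [← hinv c]
  refine Finset.sum_eq_zero fun b _ => ?_
  rw [show ∑ d, star (P b d) • x d = 0 from congrFun h0 b, smul_zero]

omit [FiniteDimensional ℂ H] [FiniteDimensional ℂ K] in
theorem transposeInjective_of_rotateCols {P : Matrix (Fin 3) (Fin 3) ℂ}
    (h : TransposeInjective fun a b => ∑ c, P c b • u a c) : TransposeInjective u := by
  intro x hx
  refine h x fun a => ?_
  simp only [LinearMap.sum_apply, LinearMap.smul_apply]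
  rw [Finset.sum_comm]
  simp [← Finset.smul_sum, hx]

end Blocks

section Reduction

variable {H K : Type} [NormedAddCommGroup H] [InnerProductSpace ℂ H] [FiniteDimensional ℂ H]
  [NormedAddCommGroup K] [InnerProductSpace ℂ K] [FiniteDimensional ℂ K]
  {u : Fin 3 → Fin 3 → H →ₗ[ℂ] K}

theorem IsRankThreeUnitary.apply_eq_zero_of_col (hu : IsRankThreeUnitary u) {j : Fin 3}
    (h : ∀ a ≠ j, u a j = 0) : Function.Injective (u j j) ∧ ∀ b ≠ j, u j b = 0 := by
  have hcol : ∀ b x y, inner ℂ (u j j x) (u j b y) = if j = b then inner ℂ x y else 0 := by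
    intro b x y
    rw [← hu.inner_columns, Finset.sum_eq_single j (fun a _ ha => by simp [h a ha]) (by simp)]
  have hinj : Function.Injective (u j j) := by
    rw [← LinearMap.ker_eq_bot, LinearMap.ker_eq_bot']
    intro x hx
    have := hcol j x x
    rwa [hx, inner_zero_left, if_pos rfl, eq_comm, inner_self_eq_zero] at this
  refine ⟨hinj, fun b hb => LinearMap.ext fun y => ext_inner_left ℂ fun k => ?_⟩
  obtain ⟨x, rfl⟩ :=
    (LinearMap.injective_iff_surjective_of_finrank_eq_finrank hu.finrank_eq).1 hinj k
  rw [hcol, if_neg hb.symm, LinearMap.zero_apply, inner_zero_right]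

theorem transposeInjective_of_col (hu : IsRankThreeUnitary u) {j : Fin 3}
    (h : ∀ a ≠ j, u a j = 0) : TransposeInjective u := by
  obtain ⟨hinj, hrow⟩ := hu.apply_eq_zero_of_col h
  have h₁ : ∀ i, u (j.succAbove i) j = 0 := fun i => h _ (Fin.succAbove_ne j i)
  have h₂ : ∀ i, u j (j.succAbove i) = 0 := fun i => hrow _ (Fin.succAbove_ne j i)
  obtain ⟨r, s, hrs⟩ := hu.expansion
  intro x hx
  have hxj : x j = 0 := by
    have := hx j
    simp only [Fin.sum_univ_succAbove _ j, h₁, LinearMap.zero_apply, Finset.sum_const_zero,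
      add_zero] at this
    exact (map_eq_zero_iff _ hinj).1 this
  have hrest : x (j.succAbove 0) = 0 ∧ x (j.succAbove 1) = 0 := by
    refine two_block_transpose_injective hu.finrank_eq
      (fun a b => u (j.succAbove a) (j.succAbove b))
      (fun i a b => r i (j.succAbove a) (j.succAbove b)) s (fun a b => hrs _ _) ?_ ?_ ?_ ?_
    · intro y z h₀ h₁'
      have := hu.eq_zero_of_forall_sum_eq_zero (x := j.insertNth 0 ![y, z]) fun a => by
        rw [Fin.sum_univ_succAbove _ j]
        simp only [Fin.insertNth_apply_same, Fin.insertNth_apply_succAbove, map_zero, zero_add,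
          Fin.sum_univ_two, Matrix.cons_val_zero, Matrix.cons_val_one]
        rcases Fin.eq_self_or_eq_succAbove j a with rfl | ⟨i, rfl⟩
        · simp [h₂]
        · fin_cases i <;> assumption
      exact ⟨by simpa using congrFun this (j.succAbove 0),
        by simpa using congrFun this (j.succAbove 1)⟩
    · intro z w
      obtain ⟨y, hy⟩ := hu.blockMap_bijective.2 (j.insertNth 0 ![z, w])
      refine ⟨y (j.succAbove 0), y (j.succAbove 1), ?_, ?_⟩
      · simpa [blockMap_apply, Fin.sum_univ_succAbove _ j, h₁] using congrFun hy (j.succAbove 0)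
      · simpa [blockMap_apply, Fin.sum_univ_succAbove _ j, h₁] using congrFun hy (j.succAbove 1)
    · simpa [Fin.sum_univ_succAbove _ j, hxj] using hx (j.succAbove 0)
    · simpa [Fin.sum_univ_succAbove _ j, hxj] using hx (j.succAbove 1)
  ext a
  rcases Fin.eq_self_or_eq_succAbove j a with rfl | ⟨i, rfl⟩
  · exact hxj
  · fin_cases i
    exacts [hrest.1, hrest.2]

theorem transposeInjective_of_row (hu : IsRankThreeUnitary u) {j : Fin 3}
    (h : ∀ b ≠ j, u j b = 0) : TransposeInjective u :=
  hu.transposeInjective_of_adjoint <| transposeInjective_of_col hu.adjoint (j := j) fun b hb => by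
    simp [h b hb]

/-- The blocks `u a b`, compressed to maps from `N` to `M`. -/
noncomputable def compress (u : Fin 3 → Fin 3 → H →ₗ[ℂ] K) (N : Submodule ℂ H) (M : Submodule ℂ K) :
    Fin 3 → Fin 3 → N →ₗ[ℂ] M :=
  fun a b => M.orthogonalProjectionOnto.toLinearMap ∘ₗ u a b ∘ₗ N.subtype

variable {N : Submodule ℂ H} {M : Submodule ℂ K}

omit [FiniteDimensional ℂ H] in
theorem coe_compress (hmap : ∀ a b, ∀ n ∈ N, u a b n ∈ M) (a b : Fin 3) (n : N) :
    (compress u N M a b n : K) = u a b n := by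
  simpa [compress] using Submodule.starProjection_eq_self_iff.2 (hmap a b n n.2)

omit [FiniteDimensional ℂ H] in
theorem IsRankThreeUnitary.compress (hu : IsRankThreeUnitary u)
    (hmap : ∀ a b, ∀ n ∈ N, u a b n ∈ M) (hNM : finrank ℂ N = finrank ℂ M) :
    IsRankThreeUnitary (compress u N M) where
  inner_columns b c x y := by
    simp only [coe_compress hmap, Submodule.coe_inner, hu.inner_columns]
  finrank_eq := hNM
  expansion := by
    obtain ⟨r, s, h⟩ := hu.expansion
    refine ⟨r, fun i => M.orthogonalProjectionOnto.toLinearMap ∘ₗ s i ∘ₗ N.subtype,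
      fun a b => LinearMap.ext fun x => ?_⟩
    simp [_root_.compress, h]

theorem transposeInjective_of_invariant (hu : IsRankThreeUnitary u)
    (ih : TransposeInjectiveBelow (finrank ℂ H)) (hN : N ≠ ⊥) (hN' : finrank ℂ N < finrank ℂ H)
    (hMN : finrank ℂ M ≤ finrank ℂ N) (hmap : ∀ a b, ∀ n ∈ N, u a b n ∈ M) :
    TransposeInjective u := by
  have hinj : Function.Injective (blockMap (compress u N M)) := by
    rw [← LinearMap.ker_eq_bot, LinearMap.ker_eq_bot']
    intro x hx
    have := hu.eq_zero_of_forall_sum_eq_zero (x := fun b => (x b : H)) fun a => by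
      have := congrArg (Subtype.val) (congrFun hx a)
      simpa [blockMap_apply, coe_compress hmap] using this
    ext b
    exact congrFun this b
  have hNM : finrank ℂ N = finrank ℂ M := by
    have := LinearMap.finrank_le_finrank_of_injective hinj
    simp only [Module.finrank_pi_fintype, Finset.sum_const, Finset.card_univ, Fintype.card_fin,
      smul_eq_mul] at this
    omega
  have hu₁ := hu.compress hmap hNM
  have hmap' : ∀ a b, ∀ n ∈ Nᗮ, u a b n ∈ Mᗮ := by
    intro a b y hy
    rw [Submodule.mem_orthogonal]
    intro m hm
    obtain ⟨x, hx⟩ := hu₁.blockMap_bijective.2 (Pi.single a ⟨m, hm⟩)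
    have hx' : ∀ c, ∑ e, u c e (x e) = if c = a then m else 0 := fun c => by
      have := congrArg (Subtype.val) (congrFun hx c)
      simp only [blockMap_apply, AddSubmonoidClass.coe_finsetSum, coe_compress hmap,
        Pi.single_apply] at this
      rw [this]
      split_ifs <;> rfl
    have h₁ : ∑ c, inner ℂ (∑ e, u c e (x e)) (u c b y) = inner ℂ m (u a b y) := by
      rw [Finset.sum_eq_single a (fun c _ hc => by rw [hx', if_neg hc, inner_zero_left])
        (by simp), hx', if_pos rfl]
    rw [← h₁]
    simp only [sum_inner]
    rw [Finset.sum_comm]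
    simp only [hu.inner_columns, Finset.sum_ite_eq', Finset.mem_univ, if_true]
    exact Submodule.inner_right_of_mem_orthogonal (x b).2 hy
  have hN₁ := Submodule.finrank_add_finrank_orthogonal N
  have hM₁ := Submodule.finrank_add_finrank_orthogonal M
  have hN₂ : 0 < finrank ℂ N := Submodule.one_le_finrank_iff.2 hN
  have heq := hu.finrank_eq
  have hu₂ := hu.compress hmap' (by omega)
  have t₁ := ih _ _ _ hN' hu₁
  have t₂ := ih _ _ _ (by omega) hu₂
  intro x hx
  have hsplit : ∀ b, (N.orthogonalProjectionOnto (x b) : H) + Nᗮ.orthogonalProjectionOnto (x b)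
      = x b := fun b => N.starProjection_add_starProjection_orthogonal (x b)
  have hzero : ∀ a, ∑ b, u b a (N.orthogonalProjectionOnto (x b)) = 0 ∧
      ∑ b, u b a (Nᗮ.orthogonalProjectionOnto (x b)) = 0 := by
    intro a
    have hs := hx a
    conv_lhs at hs => enter [2, b]; rw [← hsplit b, map_add]
    rw [Finset.sum_add_distrib] at hs
    have m₁ : ∑ b, u b a (N.orthogonalProjectionOnto (x b)) ∈ M :=
      Submodule.sum_mem _ fun b _ => hmap _ _ _ (N.orthogonalProjectionOnto (x b)).2
    have m₂ : ∑ b, u b a (Nᗮ.orthogonalProjectionOnto (x b)) ∈ Mᗮ :=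
      Submodule.sum_mem _ fun b _ => hmap' _ _ _ (Nᗮ.orthogonalProjectionOnto (x b)).2
    have h0 : ∑ b, u b a (N.orthogonalProjectionOnto (x b)) = 0 := by
      refine (Submodule.disjoint_def.1 M.orthogonal_disjoint) _ m₁ ?_
      rw [eq_neg_of_add_eq_zero_left hs]
      exact Submodule.neg_mem _ m₂
    exact ⟨h0, by rwa [h0, zero_add] at hs⟩
  have e₁ := t₁ (fun b => N.orthogonalProjectionOnto (x b)) fun a => by
    ext
    simpa [coe_compress hmap] using (hzero a).1
  have e₂ := t₂ (fun b => Nᗮ.orthogonalProjectionOnto (x b)) fun a => by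
    ext
    simpa [coe_compress hmap'] using (hzero a).2
  ext b
  rw [← hsplit b, congrFun e₁ b, congrFun e₂ b]
  simp

theorem transposeInjective_of_adjoint_invariant (hu : IsRankThreeUnitary u)
    (ih : TransposeInjectiveBelow (finrank ℂ H)) (hM : M ≠ ⊥) (hM' : finrank ℂ M < finrank ℂ H)
    (hNM : finrank ℂ N ≤ finrank ℂ M)
    (hmap : ∀ a b, ∀ m ∈ M, LinearMap.adjoint (u a b) m ∈ N) : TransposeInjective u :=
  hu.transposeInjective_of_adjoint <| transposeInjective_of_invariant hu.adjoint
    (hu.finrank_eq ▸ ih) hM (hu.finrank_eq ▸ hM') hNM fun b a => hmap a b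

end Reduction

section SmallDimension

variable {H K : Type} [NormedAddCommGroup H] [InnerProductSpace ℂ H] [FiniteDimensional ℂ H]
  [NormedAddCommGroup K] [InnerProductSpace ℂ K] [FiniteDimensional ℂ K]
  {u : Fin 3 → Fin 3 → H →ₗ[ℂ] K}

theorem IsRankThreeUnitary.apply_eq_zero_of_symmetric (hu : IsRankThreeUnitary u)
    (Λ : K →ₗ[ℂ] H →ₗ[ℂ] ℂ) (hΛ : ∀ a b x y, Λ (u a b x) y = Λ (u a b y) x) {x : Fin 3 → H}
    (hx : ∀ a, ∑ b, u b a (x b) = 0) (k : K) (b : Fin 3) : Λ k (x b) = 0 := by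
  obtain ⟨y, hy⟩ := hu.blockMap_bijective.2 (Pi.single b k)
  have hy' : ∀ c, ∑ a, u c a (y a) = if c = b then k else 0 := fun c => by
    rw [← blockMap_apply, hy, Pi.single_apply]
  calc Λ k (x b) = ∑ c, Λ (∑ a, u c a (y a)) (x c) := by
        rw [Finset.sum_eq_single b (fun c _ hc => by simp [hy', hc]) (by simp), hy', if_pos rfl]
    _ = ∑ a, Λ (∑ c, u c a (x c)) (y a) := by
        simp only [map_sum, LinearMap.sum_apply]
        rw [Finset.sum_comm]
        exact Finset.sum_congr rfl fun a _ => Finset.sum_congr rfl fun c _ => hΛ _ _ _ _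
    _ = 0 := by simp [hx]

theorem transposeInjective_of_finrank_eq_one (hu : IsRankThreeUnitary u) (hd : finrank ℂ H = 1) :
    TransposeInjective u := by
  intro x hx
  let φ : H ≃ₗ[ℂ] ℂ := LinearEquiv.ofFinrankEq H ℂ (by simp [hd])
  let ψ : K ≃ₗ[ℂ] ℂ := LinearEquiv.ofFinrankEq K ℂ (by simp [← hu.finrank_eq, hd])
  have hφ : ∀ y, y = φ y • φ.symm 1 := fun y => φ.injective (by simp)
  have := hu.apply_eq_zero_of_symmetric
    ((LinearMap.mul ℂ ℂ).compl₁₂ ψ.toLinearMap φ.toLinearMap)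
    (fun a b y z => by
      rw [hφ y, hφ z]
      simp only [map_smul, LinearMap.compl₁₂_apply, LinearMap.smul_apply]
      rw [smul_comm]) hx (ψ.symm 1)
  ext b
  simpa using this b

theorem transposeInjective_of_finrank_eq_two (hu : IsRankThreeUnitary u)
    (ih : TransposeInjectiveBelow (finrank ℂ H)) (hd : finrank ℂ H = 2) :
    TransposeInjective u := by
  obtain ⟨r, s, hrs⟩ := hu.expansion
  have hdK : finrank ℂ K = 2 := hu.finrank_eq ▸ hd
  let e := finBasisOfFinrankEq ℂ H hd
  let F : (K →ₗ[ℂ] H →ₗ[ℂ] ℂ) →ₗ[ℂ] (Fin 3 → ℂ) :=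
    { toFun := fun Λ i => Λ (s i (e 0)) (e 1) - Λ (s i (e 1)) (e 0)
      map_add' := fun Λ Λ' => by ext i; simp; ring
      map_smul' := fun c Λ => by ext i; simp; ring }
  have hker : F.ker ≠ ⊥ := LinearMap.ker_ne_bot_of_finrank_lt (by
    simp [Module.finrank_linearMap, hd, hdK])
  obtain ⟨Λ, hΛ, hΛ0⟩ := Submodule.exists_mem_ne_zero_of_ne_bot hker
  have hsymm : ∀ i x y, Λ (s i x) y = Λ (s i y) x := by
    intro i x y
    have hi : Λ (s i (e 0)) (e 1) - Λ (s i (e 1)) (e 0) = 0 := congrFun (LinearMap.mem_ker.1 hΛ) i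
    rw [← e.sum_repr x, ← e.sum_repr y]
    simp only [Fin.sum_univ_two, map_add, map_smul, LinearMap.add_apply, LinearMap.smul_apply,
      smul_eq_mul]
    linear_combination (e.repr x 0 * e.repr y 1 - e.repr x 1 * e.repr y 0) * hi
  have hsymm' : ∀ a b x y, Λ (u a b x) y = Λ (u a b y) x := fun a b x y => by
    simp only [hrs, LinearMap.sum_apply, LinearMap.smul_apply, map_sum, map_smul]
    exact Finset.sum_congr rfl fun i _ => by rw [hsymm]
  by_cases hp : ∃ p ≠ 0, ∀ k, Λ k p = 0
  · obtain ⟨p, hp0, hp⟩ := hp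
    have h₁ := finrank_span_singleton (K := ℂ) hp0
    refine transposeInjective_of_invariant hu ih (N := Submodule.span ℂ {p}) (M := Λ.ker)
      (by simpa using hp0) (by omega) ?_ ?_
    · have : finrank ℂ Λ.ker < finrank ℂ K :=
        Submodule.finrank_lt fun h => hΛ0 (LinearMap.ker_eq_top.1 h)
      omega
    · intro a b n hn
      obtain ⟨c, rfl⟩ := Submodule.mem_span_singleton.1 hn
      rw [LinearMap.mem_ker]
      ext y
      rw [hsymm', map_smul, hp]
      simp
  · intro x hx
    ext b
    by_contra h
    exact hp ⟨x b, h, fun k => hu.apply_eq_zero_of_symmetric Λ hsymm' hx k b⟩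

end SmallDimension

section NormalForm

open LinearMap (adjoint)

variable {H K : Type} [NormedAddCommGroup H] [InnerProductSpace ℂ H] [FiniteDimensional ℂ H]
  [NormedAddCommGroup K] [InnerProductSpace ℂ K] [FiniteDimensional ℂ K]
  {u : Fin 3 → Fin 3 → H →ₗ[ℂ] K}

theorem eq_zero_of_adjoint_apply_self {f : H →ₗ[ℂ] K} (h : ∀ x, adjoint f (f x) = 0) : f = 0 := by
  ext x
  rw [LinearMap.zero_apply, ← inner_self_eq_zero (𝕜 := ℂ), ← LinearMap.adjoint_inner_left, h,
    inner_zero_left]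

theorem eq_zero_of_apply_adjoint_self {f : H →ₗ[ℂ] K} (h : ∀ x, f (adjoint f x) = 0) : f = 0 := by
  have : adjoint f = 0 := eq_zero_of_adjoint_apply_self fun x => by
    rw [LinearMap.adjoint_adjoint, h]
  simpa using this

theorem adjoint_sum_smul_apply (c : Fin 3 → ℂ) (t : Fin 3 → H →ₗ[ℂ] K) (m : K) :
    adjoint (∑ k, c k • t k) m = ∑ k, star (c k) • adjoint (t k) m := by
  simp only [map_sum, LinearEquiv.map_smulₛₗ, LinearMap.sum_apply, LinearMap.smul_apply]
  rfl

theorem apply_adjoint_eq_zero_comm {f g : H →ₗ[ℂ] K} (h : ∀ x, f (adjoint g x) = 0) (x : K) :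
    g (adjoint f x) = 0 := by
  refine ext_inner_left ℂ fun y => ?_
  rw [← LinearMap.adjoint_inner_left, ← LinearMap.adjoint_inner_left, LinearMap.adjoint_adjoint,
    h, inner_zero_left, inner_zero_right]

theorem adjoint_apply_eq_zero_comm {f g : H →ₗ[ℂ] K} (h : ∀ x, adjoint f (g x) = 0) (x : H) :
    adjoint g (f x) = 0 := by
  refine ext_inner_left ℂ fun y => ?_
  rw [LinearMap.adjoint_inner_right, ← LinearMap.adjoint_inner_left, h, inner_zero_left,
    inner_zero_right]

omit [FiniteDimensional ℂ H] [FiniteDimensional ℂ K] in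
theorem IsRankThreeUnitary.exists_relation_or_span (hu : IsRankThreeUnitary u)
    (t : Fin 3 → H →ₗ[ℂ] K) (ht : ∀ k, ∃ a b, t k = u a b) :
    (∃ c : Fin 3 → ℂ, c ≠ 0 ∧ ∑ k, c k • t k = 0) ∨
      ∀ a b, ∃ c : Fin 3 → ℂ, u a b = ∑ k, c k • t k := by
  obtain ⟨r, s, hrs⟩ := hu.expansion
  have hmem : ∀ a b, u a b ∈ Submodule.span ℂ (Set.range s) := fun a b => by
    rw [hrs]
    exact Submodule.sum_mem _ fun i _ =>
      Submodule.smul_mem _ _ (Submodule.subset_span (Set.mem_range_self i))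
  refine (exists_relation_or_span_le s t fun k => ?_).imp_right fun h a b => ?_
  · obtain ⟨a, b, hk⟩ := ht k
    exact hk ▸ hmem a b
  · obtain ⟨c, hc⟩ := h _ (hmem a b)
    exact ⟨c, hc.symm⟩

theorem finrank_ker_adjoint (f : H →ₗ[ℂ] K) (h : finrank ℂ H = finrank ℂ K) :
    finrank ℂ (adjoint f).ker = finrank ℂ f.ker := by
  have h₁ := Submodule.finrank_add_finrank_orthogonal f.range
  have h₂ := f.finrank_range_add_finrank_ker
  rw [← LinearMap.orthogonal_range]
  omega

omit [FiniteDimensional ℂ H] [FiniteDimensional ℂ K] in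
/-- In a relation between `f`, `g` and `h`, where `f` and `g` are linearly independent, the
coefficient of `h` is nonzero. -/
theorem exists_eq_add_of_relation {f g h : H →ₗ[ℂ] K} {v : H} (hfv : f v ≠ 0) (hgv : g v = 0)
    (hg : g ≠ 0) {c : Fin 3 → ℂ} (hc : c ≠ 0) (hrel : ∑ k, c k • ![f, g, h] k = 0) :
    ∃ a b : ℂ, h = a • f + b • g := by
  simp only [Fin.sum_univ_three, Matrix.cons_val] at hrel
  have h2 : c 2 ≠ 0 := by
    intro h2
    rw [h2, zero_smul, add_zero] at hrel
    have h0 : c 0 = 0 := by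
      have := LinearMap.congr_fun hrel v
      simpa [hgv, hfv] using this
    have h1 : c 1 = 0 := by simpa [h0, hg] using hrel
    exact hc (by ext i; fin_cases i <;> assumption)
  refine ⟨-(c 0 / c 2), -(c 1 / c 2), ?_⟩
  apply smul_right_injective _ h2
  simp only [smul_add, smul_smul]
  rw [eq_neg_of_add_eq_zero_right hrel, neg_add, ← neg_smul, ← neg_smul]
  congr 2 <;> field_simp

/-- The case where the off-diagonal blocks `u 0 1` and `u 1 0` are proportional. -/
theorem transposeInjective_of_proportional (hu : IsRankThreeUnitary u)
    (ih : TransposeInjectiveBelow (finrank ℂ H)) (h20 : u 2 0 = 0) (h02 : u 0 2 = 0) {v : H}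
    (hv : v ≠ 0) (h10 : u 1 0 v = 0) {κ : ℂ} (hκ : u 0 1 = κ • u 1 0) : TransposeInjective u := by
  by_contra hT
  have hB : u 1 0 ≠ 0 := fun h => hT <| transposeInjective_of_col hu (j := 0) fun a ha => by
    fin_cases a <;> simp_all
  have hC : κ ≠ 0 := fun h => hT <| transposeInjective_of_row hu (j := 0) fun a ha => by
    fin_cases a <;> simp_all
  have hX : u 2 1 ≠ 0 := fun h => hT <| transposeInjective_of_row hu (j := 2) fun a ha => by
    fin_cases a <;> simp_all
  have hE : u 1 2 ≠ 0 := fun h => hT <| transposeInjective_of_col hu (j := 2) fun a ha => by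
    fin_cases a <;> simp_all
  have col00 : ∀ x, adjoint (u 0 0) (u 0 0 x) + adjoint (u 1 0) (u 1 0 x) = x := fun x => by
    simpa [Fin.sum_univ_three, h20] using hu.sum_adjoint_apply 0 0 x
  have col10 : ∀ x, adjoint (u 0 1) (u 0 0 x) + adjoint (u 1 1) (u 1 0 x) = 0 := fun x => by
    simpa [Fin.sum_univ_three, h20] using hu.sum_adjoint_apply 1 0 x
  have col01 : ∀ x, adjoint (u 0 0) (u 0 1 x) + adjoint (u 1 0) (u 1 1 x) = 0 := fun x => by
    simpa [Fin.sum_univ_three, h20] using hu.sum_adjoint_apply 0 1 x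
  have col02 : ∀ x, adjoint (u 1 0) (u 1 2 x) = 0 := fun x => by
    simpa [Fin.sum_univ_three, h20, h02] using hu.sum_adjoint_apply 0 2 x
  have row10 : ∀ x, u 1 0 (adjoint (u 0 0) x) + u 1 1 (adjoint (u 0 1) x) = 0 := fun x => by
    simpa [Fin.sum_univ_three, h02] using hu.sum_apply_adjoint 1 0 x
  have row02 : ∀ x, u 0 1 (adjoint (u 2 1) x) = 0 := fun x => by
    simpa [Fin.sum_univ_three, h20, h02] using hu.sum_apply_adjoint 0 2 x
  have row12 : ∀ x, u 1 1 (adjoint (u 2 1) x) + u 1 2 (adjoint (u 2 2) x) = 0 := fun x => by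
    simpa [Fin.sum_univ_three, h20] using hu.sum_apply_adjoint 1 2 x
  have hCadj : ∀ x, adjoint (u 0 1) x = star κ • adjoint (u 1 0) x := fun x => by
    rw [hκ, LinearEquiv.map_smulₛₗ]; rfl
  have hBX : ∀ x, u 1 0 (adjoint (u 2 1) x) = 0 := fun x => by
    simpa [hκ, hC] using row02 x
  have hXB := apply_adjoint_eq_zero_comm hBX
  have hAM : ∀ n, u 1 0 n = 0 → adjoint (u 1 0) (u 0 0 n) = 0 := fun n hn => by
    simpa [hCadj, hn, hC] using col10 n
  have hAN : ∀ m, adjoint (u 1 0) m = 0 → u 1 0 (adjoint (u 0 0) m) = 0 := fun m hm => by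
    simpa [hCadj, hm] using row10 m
  have hker := finrank_ker_adjoint (u 1 0) hu.finrank_eq
  have hN : (u 1 0).ker ≠ ⊥ := fun h => hv (by
    have : v ∈ (u 1 0).ker := h10
    simpa [h] using this)
  have hN' : finrank ℂ (u 1 0).ker < finrank ℂ H :=
    Submodule.finrank_lt fun h => hB (LinearMap.ker_eq_top.1 h)
  have hM : (adjoint (u 1 0)).ker ≠ ⊥ := fun h => hN (by
    rw [h, finrank_bot] at hker
    exact Submodule.finrank_eq_zero.1 hker.symm)
  have hA : u 0 0 v ≠ 0 := fun h => hv (by simpa [h, h10] using (col00 v).symm)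
  obtain ⟨ξ₁, ξ₂, hξ⟩ : ∃ a b : ℂ, u 2 1 = a • u 0 0 + b • u 1 0 := by
    rcases hu.exists_relation_or_span ![u 0 0, u 1 0, u 2 1]
      (by intro k; fin_cases k; exacts [⟨0, 0, rfl⟩, ⟨1, 0, rfl⟩, ⟨2, 1, rfl⟩]) with
      ⟨c, hc, hrel⟩ | hspan
    · exact exists_eq_add_of_relation hA h10 hB hc hrel
    · refine absurd (transposeInjective_of_adjoint_invariant hu ih hM (hker ▸ hN') hker.ge ?_) hT
      intro a b m hm
      rw [LinearMap.mem_ker] at hm ⊢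
      obtain ⟨c, hc⟩ := hspan a b
      rw [hc, adjoint_sum_smul_apply]
      simp [Fin.sum_univ_three, hm, hAN m hm, hBX]
  obtain ⟨η₁, η₂, hη⟩ : ∃ a b : ℂ, u 1 2 = a • u 0 0 + b • u 1 0 := by
    rcases hu.exists_relation_or_span ![u 0 0, u 1 0, u 1 2]
      (by intro k; fin_cases k; exacts [⟨0, 0, rfl⟩, ⟨1, 0, rfl⟩, ⟨1, 2, rfl⟩]) with
      ⟨c, hc, hrel⟩ | hspan
    · exact exists_eq_add_of_relation hA h10 hB hc hrel
    · refine absurd (transposeInjective_of_invariant hu ih hN hN' hker.le ?_) hT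
      intro a b n hn
      rw [LinearMap.mem_ker] at hn ⊢
      obtain ⟨c, hc⟩ := hspan a b
      rw [hc]
      simp [Fin.sum_univ_three, hn, hAM n hn, col02]
  have hη₁ : η₁ ≠ 0 := by
    rintro rfl
    rw [zero_smul, zero_add] at hη
    refine hE (eq_zero_of_adjoint_apply_self fun x => ?_)
    conv_lhs => rw [hη]
    rw [LinearEquiv.map_smulₛₗ, LinearMap.smul_apply, ← hη, col02, smul_zero]
  have hratio : η₁ * ξ₂ = ξ₁ * η₂ := by
    by_contra hne
    apply hB
    apply eq_zero_of_apply_adjoint_self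
    intro x
    rw [← inner_self_eq_zero (𝕜 := ℂ), ← LinearMap.adjoint_inner_left]
    have e₁ := congrArg (adjoint (u 1 0)) (hXB x)
    have e₂ := col02 (adjoint (u 1 0) x)
    simp only [hξ, hη, LinearMap.add_apply, LinearMap.smul_apply, map_add, map_smul,
      map_zero] at e₁ e₂
    have e₃ : (η₁ * ξ₂ - ξ₁ * η₂) • adjoint (u 1 0) (u 1 0 (adjoint (u 1 0) x)) = 0 := by
      linear_combination (norm := module) η₁ • e₁ - ξ₁ • e₂
    rw [(smul_eq_zero.1 e₃).resolve_left (sub_ne_zero.2 hne), inner_zero_left]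
  have hBX' : ∀ x, adjoint (u 1 0) (u 2 1 x) = 0 := fun x => by
    have e := col02 x
    simp only [hη, LinearMap.add_apply, LinearMap.smul_apply, map_add, map_smul] at e
    apply smul_right_injective _ hη₁
    simp only [hξ, smul_zero, LinearMap.add_apply, LinearMap.smul_apply, map_add, map_smul]
    rw [smul_add, smul_smul, smul_smul, hratio]
    linear_combination (norm := module) ξ₁ • e
  have hX'B := adjoint_apply_eq_zero_comm hBX'
  have hYM : ∀ n, u 1 0 n = 0 → adjoint (u 1 0) (u 2 2 n) = 0 := by
    intro n hn
    refine ext_inner_right ℂ fun k => ?_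
    rw [LinearMap.adjoint_inner_left, ← LinearMap.adjoint_inner_right, inner_zero_left]
    set y := adjoint (u 2 2) (u 1 0 k) with hy
    have hEy : u 1 2 y = 0 := by simpa [hX'B] using row12 (u 1 0 k)
    have hAy : inner ℂ (u 0 0 n) (u 0 0 y) = 0 := by
      have := congrArg (inner ℂ (u 0 0 n)) hEy
      rw [hη, LinearMap.add_apply, LinearMap.smul_apply, LinearMap.smul_apply, inner_add_right,
        inner_smul_right, inner_smul_right, ← LinearMap.adjoint_inner_left (u 1 0), hAM n hn,
        inner_zero_left, inner_zero_right, mul_zero, add_zero] at this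
      exact (mul_eq_zero.1 this).resolve_left hη₁
    rw [← col00 n, hn, map_zero, add_zero, LinearMap.adjoint_inner_left, hAy]
  refine hT (transposeInjective_of_invariant hu ih hN hN' hker.le ?_)
  intro a b n hn
  rw [LinearMap.mem_ker] at hn ⊢
  have hGM : adjoint (u 1 0) (u 1 1 n) = 0 := by simpa [hκ, hn] using col01 n
  fin_cases a <;> fin_cases b <;> simp [*]

/-- The case where the blocks `u 0 0`, `u 1 0` and `u 0 1` span all blocks. -/
theorem transposeInjective_of_span (hu : IsRankThreeUnitary u)
    (ih : TransposeInjectiveBelow (finrank ℂ H)) (hd : 3 ≤ finrank ℂ H) (h20 : u 2 0 = 0)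
    (h02 : u 0 2 = 0) {v : H} (hv : v ≠ 0) (h10 : u 1 0 v = 0)
    (hspan : ∀ a b, ∃ c : Fin 3 → ℂ, u a b = ∑ k, c k • ![u 0 0, u 1 0, u 0 1] k) :
    TransposeInjective u := by
  by_contra hT
  have hX : u 2 1 ≠ 0 := fun h => hT <| transposeInjective_of_row hu (j := 2) fun a ha => by
    fin_cases a <;> simp_all
  have row02 : ∀ x, u 0 1 (adjoint (u 2 1) x) = 0 := fun x => by
    simpa [Fin.sum_univ_three, h20, h02] using hu.sum_apply_adjoint 0 2 x
  have row01 : ∀ x, u 0 0 (adjoint (u 1 0) x) + u 0 1 (adjoint (u 1 1) x) = 0 := fun x => by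
    simpa [Fin.sum_univ_three, h02] using hu.sum_apply_adjoint 0 1 x
  have row11 : ∀ x, u 1 0 (adjoint (u 1 0) x) + u 1 1 (adjoint (u 1 1) x)
      + u 1 2 (adjoint (u 1 2) x) = x := fun x => by
    simpa [Fin.sum_univ_three] using hu.sum_apply_adjoint 1 1 x
  set w := u 0 0 v with hw
  set m := u 0 1 v with hm
  set n := adjoint (u 1 0) w with hn
  have hAw : adjoint (u 0 0) w = v := by
    simpa [Fin.sum_univ_three, h20, h10] using hu.sum_adjoint_apply 0 0 v
  have hCw : adjoint (u 0 1) w = 0 := by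
    simpa [Fin.sum_univ_three, h20, h10] using hu.sum_adjoint_apply 1 0 v
  have hw0 : w ≠ 0 := fun h => hv (by rw [← hAw, h, map_zero])
  have hvn : inner ℂ v n = 0 := by
    rw [hn, LinearMap.adjoint_inner_right, h10, inner_zero_left]
  have hadj : ∀ (c : Fin 3 → ℂ), adjoint (∑ k, c k • ![u 0 0, u 1 0, u 0 1] k) w
      = star (c 0) • v + star (c 1) • n := fun c => by
    rw [adjoint_sum_smul_apply]
    simp [Fin.sum_univ_three, hAw, hCw, ← hn]
  have hm0 : m ≠ 0 := by
    intro h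
    refine hT (transposeInjective_of_invariant hu ih (N := Submodule.span ℂ {v})
      (M := Submodule.span ℂ {w}) (by simpa using hv) ?_ ?_ ?_)
    · rw [finrank_span_singleton hv]; omega
    · rw [finrank_span_singleton hv, finrank_span_singleton hw0]
    · intro a b x hx
      obtain ⟨k, rfl⟩ := Submodule.mem_span_singleton.1 hx
      obtain ⟨c, hc⟩ := hspan a b
      refine Submodule.mem_span_singleton.2 ⟨k * c 0, ?_⟩
      simp [hc, Fin.sum_univ_three, h10, ← hw, ← hm, h, mul_smul]
  have hn0 : n ≠ 0 := by
    intro h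
    refine hT (transposeInjective_of_adjoint_invariant hu ih (N := Submodule.span ℂ {v})
      (M := Submodule.span ℂ {w}) (by simpa using hw0) ?_ ?_ ?_)
    · rw [finrank_span_singleton hw0]; omega
    · rw [finrank_span_singleton hv, finrank_span_singleton hw0]
    · intro a b x hx
      obtain ⟨k, rfl⟩ := Submodule.mem_span_singleton.1 hx
      obtain ⟨c, hc⟩ := hspan a b
      refine Submodule.mem_span_singleton.2 ⟨k * star (c 0), ?_⟩
      rw [map_smul, hc, hadj, h, smul_zero, add_zero, smul_smul]
  obtain ⟨x, hx⟩ := hspan 2 1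
  obtain ⟨g, hg⟩ := hspan 1 1
  obtain ⟨e, he⟩ := hspan 1 2
  have hXw : adjoint (u 2 1) w = star (x 0) • v + star (x 1) • n := by rw [hx, hadj]
  have hGw : adjoint (u 1 1) w = star (g 0) • v + star (g 1) • n := by rw [hg, hadj]
  have hEw : adjoint (u 1 2) w = star (e 0) • v + star (e 1) • n := by rw [he, hadj]
  have hCn : star (x 0) • m + star (x 1) • u 0 1 n = 0 := by
    have := row02 w
    rwa [hXw, map_add, map_smul, map_smul] at this
  have hx1 : x 1 ≠ 0 := by
    intro h1
    have h0 : x 0 = 0 := by simpa [h1, hm0] using hCn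
    have hx' : u 2 1 = x 2 • u 0 1 := by
      rw [hx]; simp [Fin.sum_univ_three, h0, h1]
    refine hX (eq_zero_of_apply_adjoint_self fun y => ?_)
    conv_lhs => enter [1]; rw [hx']
    rw [LinearMap.smul_apply, row02, smul_zero]
  have hwM : w ∈ Submodule.span ℂ {w, m} := Submodule.subset_span (by simp)
  have hmM : m ∈ Submodule.span ℂ {w, m} := Submodule.subset_span (by simp)
  have hCnM : u 0 1 n ∈ Submodule.span ℂ {w, m} := by
    have hx1' : star (x 1) ≠ 0 := star_ne_zero.2 hx1
    refine (Submodule.smul_mem_iff _ hx1').1 ?_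
    rw [eq_neg_of_add_eq_zero_right hCn]
    exact Submodule.neg_mem _ (Submodule.smul_mem _ _ hmM)
  have hAnM : u 0 0 n ∈ Submodule.span ℂ {w, m} := by
    have := row01 w
    rw [← hn, hGw, map_add, map_smul, map_smul, ← hm] at this
    rw [eq_neg_of_add_eq_zero_left this]
    exact Submodule.neg_mem _ (Submodule.add_mem _ (Submodule.smul_mem _ _ hmM)
      (Submodule.smul_mem _ _ hCnM))
  have hBnM : u 1 0 n ∈ Submodule.span ℂ {w, m} := by
    have hpos : (1 + g 1 * star (g 1) + e 1 * star (e 1)) ≠ 0 := by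
      have : (1 + g 1 * star (g 1) + e 1 * star (e 1))
          = ((1 + Complex.normSq (g 1) + Complex.normSq (e 1) : ℝ) : ℂ) := by
        push_cast
        rw [Complex.normSq_eq_conj_mul_self, Complex.normSq_eq_conj_mul_self]
        simp only [RCLike.star_def]
        ring
      rw [this, Complex.ofReal_ne_zero]
      have := Complex.normSq_nonneg (g 1)
      have := Complex.normSq_nonneg (e 1)
      positivity
    refine (Submodule.smul_mem_iff _ hpos).1 ?_
    have := row11 w
    rw [← hn, hGw, hEw, hg, he] at this
    simp only [Fin.sum_univ_three, Matrix.cons_val, LinearMap.add_apply, LinearMap.smul_apply,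
      map_add, map_smul, h10, ← hw, ← hm] at this
    have hcomb : (1 + g 1 * star (g 1) + e 1 * star (e 1)) • u 1 0 n
        = (1 - g 0 * star (g 0) - e 0 * star (e 0)) • w
          - (g 2 * star (g 0) + e 2 * star (e 0)) • m
          - (g 0 * star (g 1) + e 0 * star (e 1)) • u 0 0 n
          - (g 2 * star (g 1) + e 2 * star (e 1)) • u 0 1 n := by
      linear_combination (norm := module) this
    rw [hcomb]
    exact Submodule.sub_mem _ (Submodule.sub_mem _ (Submodule.sub_mem _
      (Submodule.smul_mem _ _ hwM) (Submodule.smul_mem _ _ hmM)) (Submodule.smul_mem _ _ hAnM))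
      (Submodule.smul_mem _ _ hCnM)
  have hli : LinearIndependent ℂ ![v, n] := by
    rw [LinearIndependent.pair_iff]
    intro s t hst
    have h₁ := congrArg (inner ℂ v) hst
    have h₂ := congrArg (inner ℂ n) hst
    have hnv : inner ℂ n v = 0 := inner_eq_zero_symm.1 hvn
    simp only [inner_add_right, inner_smul_right, hvn, hnv, mul_zero, add_zero, zero_add,
      inner_zero_right, mul_eq_zero, inner_self_eq_zero, hv, hn0, or_false] at h₁ h₂
    exact ⟨h₁, h₂⟩
  have hN : finrank ℂ (Submodule.span ℂ (Set.range ![v, n])) = 2 := by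
    simpa using finrank_span_eq_card hli
  have hM : finrank ℂ (Submodule.span ℂ {w, m}) ≤ 2 := by
    have := finrank_range_le_card (R := ℂ) ![w, m]
    rwa [Matrix.range_cons_cons_empty, Fintype.card_fin] at this
  refine hT (transposeInjective_of_invariant hu ih (M := Submodule.span ℂ {w, m})
    (fun h => ?_) (hN ▸ hd) (hN ▸ hM) ?_)
  · rw [h, finrank_bot] at hN
    omega
  · intro a b y hy
    rw [Matrix.range_cons_cons_empty] at hy
    obtain ⟨p, q, rfl⟩ := Submodule.mem_span_pair.1 hy
    have hall : ∀ z, u 0 0 z ∈ Submodule.span ℂ {w, m} → u 1 0 z ∈ Submodule.span ℂ {w, m} →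
        u 0 1 z ∈ Submodule.span ℂ {w, m} → u a b z ∈ Submodule.span ℂ {w, m} := by
      intro z h₀ h₁ h₂
      obtain ⟨c, hc⟩ := hspan a b
      rw [hc]
      simp only [Fin.sum_univ_three, Matrix.cons_val, LinearMap.add_apply, LinearMap.smul_apply]
      exact Submodule.add_mem _ (Submodule.add_mem _ (Submodule.smul_mem _ _ h₀)
        (Submodule.smul_mem _ _ h₁)) (Submodule.smul_mem _ _ h₂)
    rw [map_add, map_smul, map_smul]
    exact Submodule.add_mem _ (Submodule.smul_mem _ _ (hall v hwM (by simp [h10]) hmM))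
      (Submodule.smul_mem _ _ (hall n hAnM hBnM hCnM))

theorem transposeInjective_of_normalForm (hu : IsRankThreeUnitary u)
    (ih : TransposeInjectiveBelow (finrank ℂ H)) (hd : 3 ≤ finrank ℂ H) (h20 : u 2 0 = 0)
    (h02 : u 0 2 = 0) {v : H} (hv : v ≠ 0) (h10 : u 1 0 v = 0) : TransposeInjective u := by
  by_cases hB : u 1 0 = 0
  · exact transposeInjective_of_col hu (j := 0) fun a ha => by fin_cases a <;> simp_all
  have hAw : adjoint (u 0 0) (u 0 0 v) = v := by
    simpa [Fin.sum_univ_three, h20, h10] using hu.sum_adjoint_apply 0 0 v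
  have hCw : adjoint (u 0 1) (u 0 0 v) = 0 := by
    simpa [Fin.sum_univ_three, h20, h10] using hu.sum_adjoint_apply 1 0 v
  have hA : u 0 0 v ≠ 0 := fun h => hv (by rw [← hAw, h, map_zero])
  rcases hu.exists_relation_or_span ![u 0 0, u 1 0, u 0 1]
    (by intro k; fin_cases k; exacts [⟨0, 0, rfl⟩, ⟨1, 0, rfl⟩, ⟨0, 1, rfl⟩]) with
    ⟨c, hc, hrel⟩ | hspan
  · obtain ⟨a, b, hab⟩ := exists_eq_add_of_relation hA h10 hB hc hrel
    have ha : a = 0 := by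
      have := congrArg (fun x => inner ℂ x v) hCw
      simp only [LinearMap.adjoint_inner_left, inner_zero_left] at this
      rw [hab, LinearMap.add_apply, LinearMap.smul_apply, LinearMap.smul_apply, h10, smul_zero,
        add_zero, inner_smul_right, mul_eq_zero, inner_self_eq_zero] at this
      exact this.resolve_right hA
    rw [ha, zero_smul, zero_add] at hab
    exact transposeInjective_of_proportional hu ih h20 h02 hv h10 hab
  · exact transposeInjective_of_span hu ih hd h20 h02 hv h10 hspan

end NormalForm

section Rotation

theorem transpose_mem_unitaryGroup {P : Matrix (Fin 3) (Fin 3) ℂ}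
    (hP : P ∈ Matrix.unitaryGroup (Fin 3) ℂ) : Pᵀ ∈ Matrix.unitaryGroup (Fin 3) ℂ := by
  rw [Matrix.mem_unitaryGroup_iff']
  have := congrArg Matrix.transpose (Matrix.mem_unitaryGroup_iff.1 hP)
  rwa [Matrix.transpose_mul, Matrix.transpose_one] at this

theorem exists_unitary_of_orthonormal {s : Set (Fin 3)} {w : Fin 3 → EuclideanSpace ℂ (Fin 3)}
    (hw : Orthonormal ℂ (s.domRestrict w)) :
    ∃ P ∈ Matrix.unitaryGroup (Fin 3) ℂ, ∀ i ∈ s, P i = w i := by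
  obtain ⟨b, hb⟩ := hw.exists_orthonormalBasis_extension_of_card_eq (by simp)
  refine ⟨Matrix.of fun i => b i, ?_, fun i hi => by rw [← hb i hi]; rfl⟩
  rw [Matrix.mem_unitaryGroup_iff]
  ext i j
  have := orthonormal_iff_ite.1 b.orthonormal j i
  rw [PiLp.inner_apply] at this
  simp only [RCLike.inner_apply] at this
  simp only [Matrix.mul_apply, Matrix.star_apply, Matrix.of_apply, Matrix.one_apply,
    eq_comm (a := i)]
  exact this

theorem exists_unitary_row (j : Fin 3) {l : Fin 3 → ℂ} (hl : l ≠ 0) :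
    ∃ P ∈ Matrix.unitaryGroup (Fin 3) ℂ, ∃ c : ℂ, P j = c • l := by
  have hl' : ‖WithLp.toLp 2 l‖ ≠ 0 := by simpa using hl
  obtain ⟨P, hP, h⟩ := exists_unitary_of_orthonormal (s := {j})
    (w := fun _ => ((‖WithLp.toLp 2 l‖⁻¹ : ℝ) : ℂ) • WithLp.toLp 2 l) (by
      refine ⟨fun i => ?_, fun i i' hii => absurd (Subsingleton.elim i i') hii⟩
      simp [norm_smul, hl'])
  exact ⟨P, hP, _, h j rfl⟩

theorem exists_unitary_two_rows {j k : Fin 3} (hjk : j ≠ k) {l : Fin 3 → ℂ} (hl : l ≠ 0)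
    (hlk : l k = 0) :
    ∃ P ∈ Matrix.unitaryGroup (Fin 3) ℂ, (∃ c : ℂ, P j = c • l) ∧ P k = Pi.single k 1 := by
  have hl' : ‖WithLp.toLp 2 l‖ ≠ 0 := by simpa using hl
  obtain ⟨P, hP, h⟩ := exists_unitary_of_orthonormal (s := {j, k})
    (w := fun i => if i = j then ((‖WithLp.toLp 2 l‖⁻¹ : ℝ) : ℂ) • WithLp.toLp 2 l
      else EuclideanSpace.single k 1) (by
      refine ⟨?_, ?_⟩
      · rintro ⟨i, rfl | rfl⟩ <;> simp [norm_smul, hl', hjk.symm]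
      · rintro ⟨i, rfl | rfl⟩ ⟨i', rfl | rfl⟩ hii
        · exact absurd rfl hii
        · simp [hjk.symm, hlk, inner_smul_left, EuclideanSpace.inner_single_right]
        · simp [hjk.symm, hlk, inner_smul_right, EuclideanSpace.inner_single_left]
        · exact absurd rfl hii)
  refine ⟨P, hP, ⟨((‖WithLp.toLp 2 l‖⁻¹ : ℝ) : ℂ), (h j (by simp)).trans (by simp)⟩,
    (h k (by simp)).trans ?_⟩
  ext i
  simp [hjk.symm, Pi.single_apply]

end Rotation

section Main

open LinearMap (adjoint)

variable {H K : Type} [NormedAddCommGroup H] [InnerProductSpace ℂ H] [FiniteDimensional ℂ H]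
  [NormedAddCommGroup K] [InnerProductSpace ℂ K] [FiniteDimensional ℂ K]
  {u : Fin 3 → Fin 3 → H →ₗ[ℂ] K}

theorem transposeInjective_of_corner_kernel (hu : IsRankThreeUnitary u)
    (ih : TransposeInjectiveBelow (finrank ℂ H)) (hd : 3 ≤ finrank ℂ H) (h20 : u 2 0 = 0) {v : H}
    (hv : v ≠ 0) (h10 : u 1 0 v = 0) : TransposeInjective u := by
  have hAw : adjoint (u 0 0) (u 0 0 v) = v := by
    simpa [Fin.sum_univ_three, h20, h10] using hu.sum_adjoint_apply 0 0 v
  have hCw : adjoint (u 0 1) (u 0 0 v) = 0 := by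
    simpa [Fin.sum_univ_three, h20, h10] using hu.sum_adjoint_apply 1 0 v
  have hDw : adjoint (u 0 2) (u 0 0 v) = 0 := by
    simpa [Fin.sum_univ_three, h20, h10] using hu.sum_adjoint_apply 2 0 v
  have hw : u 0 0 v ≠ 0 := fun h => hv (by rw [← hAw, h, map_zero])
  have hadj : ∀ c : Fin 3 → ℂ, adjoint (∑ k, c k • u 0 k) (u 0 0 v) = star (c 0) • v := fun c => by
    rw [adjoint_sum_smul_apply]
    simp [Fin.sum_univ_three, hAw, hCw, hDw]
  rcases hu.exists_relation_or_span (u 0) (fun k => ⟨0, k, rfl⟩) with ⟨c, hc, hrel⟩ | hspan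
  · have hc0 : c 0 = 0 := by
      have := hadj c
      rw [hrel, map_zero, LinearMap.zero_apply, eq_comm, smul_eq_zero, star_eq_zero] at this
      exact this.resolve_right hv
    obtain ⟨P, hP, ⟨k, hk⟩, h0⟩ := exists_unitary_two_rows (j := 2) (k := 0) (by simp) hc hc0
    have hcol : ∀ a, ∑ c, P 0 c • u a c = u a 0 := fun a => by
      simp [h0, Pi.single_apply]
    refine transposeInjective_of_rotateCols (P := Pᵀ)
      (transposeInjective_of_normalForm (hu.rotateCols (transpose_mem_unitaryGroup hP))
        ih hd ?_ ?_ hv ?_)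
    · simp only [Matrix.transpose_apply, hcol, h20]
    · simp only [Matrix.transpose_apply, hk, Pi.smul_apply, smul_assoc, ← Finset.smul_sum, hrel,
        smul_zero]
    · simp only [Matrix.transpose_apply, hcol, h10]
  · refine transposeInjective_of_adjoint_invariant hu ih (N := Submodule.span ℂ {v})
      (M := Submodule.span ℂ {u 0 0 v}) (by simpa using hw) ?_ ?_ ?_
    · rw [finrank_span_singleton hw]; omega
    · rw [finrank_span_singleton hv, finrank_span_singleton hw]
    · intro a b x hx
      obtain ⟨k, rfl⟩ := Submodule.mem_span_singleton.1 hx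
      obtain ⟨c, hc⟩ := hspan a b
      rw [map_smul, hc, hadj]
      exact Submodule.smul_mem _ _ (Submodule.smul_mem _ _ (Submodule.mem_span_singleton_self v))

theorem transposeInjective_of_corner (hu : IsRankThreeUnitary u)
    (ih : TransposeInjectiveBelow (finrank ℂ H)) (hd : 3 ≤ finrank ℂ H) (h20 : u 2 0 = 0) :
    TransposeInjective u := by
  have : Nontrivial H := Module.nontrivial_of_finrank_pos (R := ℂ) (by omega)
  obtain ⟨α, β, hαβ, v, hv, hrel⟩ := exists_pencil_kernel hu.finrank_eq (u 0 0) (u 1 0)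
  obtain ⟨P, hP, ⟨k, hk⟩, h2⟩ := exists_unitary_two_rows (j := 1) (k := 2) (by simp)
    (l := ![α, β, 0]) (by
      intro h
      rcases hαβ with h' | h'
      · exact h' (by simpa using congrFun h 0)
      · exact h' (by simpa using congrFun h 1)) (by simp)
  refine transposeInjective_of_rotateRows hP
    (transposeInjective_of_corner_kernel (hu.rotateRows hP) ih hd ?_ hv ?_)
  · simp [h2, Pi.single_apply, h20]
  · simp only [hk, Fin.sum_univ_three, Pi.smul_apply, LinearMap.add_apply, LinearMap.smul_apply,
      Matrix.cons_val, smul_assoc, zero_smul, smul_zero, add_zero]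
    rw [← smul_add, hrel, smul_zero]

theorem transposeInjective_of_three_le (hu : IsRankThreeUnitary u)
    (ih : TransposeInjectiveBelow (finrank ℂ H)) (hd : 3 ≤ finrank ℂ H) :
    TransposeInjective u := by
  obtain ⟨r, s, hrs⟩ := hu.expansion
  obtain ⟨α, β, hαβ, l, hl, hrel⟩ := exists_pencil_kernel (V := Fin 3 → ℂ) (W := Fin 3 → ℂ) rfl
    (Matrix.mulVecLin (Matrix.of fun i x => r i x 0))
    (Matrix.mulVecLin (Matrix.of fun i x => r i x 1))
  have hzero : ∑ x, l x • (α • u x 0 + β • u x 1) = 0 := by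
    have : ∀ x, l x • (α • u x 0 + β • u x 1)
        = ∑ i, (α * (r i x 0 * l x) + β * (r i x 1 * l x)) • s i := fun x => by
      simp only [hrs, Finset.smul_sum, ← Finset.sum_add_distrib]
      refine Finset.sum_congr rfl fun i _ => ?_
      module
    rw [Finset.sum_congr rfl fun x _ => this x, Finset.sum_comm]
    refine Finset.sum_eq_zero fun i _ => ?_
    rw [← Finset.sum_smul]
    have := congrFun hrel i
    simp only [Pi.add_apply, Pi.smul_apply, Matrix.mulVecLin_apply, Matrix.mulVec, dotProduct,
      Matrix.of_apply, smul_eq_mul, Pi.zero_apply] at this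
    rw [Finset.sum_add_distrib, ← Finset.mul_sum, ← Finset.mul_sum, this, zero_smul]
  obtain ⟨Q, hQ, k, hk⟩ := exists_unitary_row 0 (l := ![α, β, 0]) (by
    intro h
    rcases hαβ with h' | h'
    · exact h' (by simpa using congrFun h 0)
    · exact h' (by simpa using congrFun h 1))
  obtain ⟨P, hP, k', hk'⟩ := exists_unitary_row 2 hl
  refine transposeInjective_of_rotateCols (P := Qᵀ) (transposeInjective_of_rotateRows hP
    (transposeInjective_of_corner
      ((hu.rotateCols (transpose_mem_unitaryGroup hQ)).rotateRows hP) ih hd ?_))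
  have hcol : ∀ x, ∑ c, Q 0 c • u x c = k • (α • u x 0 + β • u x 1) := fun x => by
    simp [hk, Fin.sum_univ_three, mul_smul]
  simp only [Matrix.transpose_apply, hcol, hk', Pi.smul_apply, smul_assoc]
  simp only [smul_comm _ k, ← Finset.smul_sum, hzero, smul_zero]

theorem transposeInjectiveBelow (d : ℕ) : TransposeInjectiveBelow d := by
  induction d with
  | zero => exact fun H K _ _ _ _ _ _ u h => absurd h (Nat.not_lt_zero _)
  | succ d ih =>
    intro H K _ _ _ _ _ _ u h hu
    rcases Nat.lt_succ_iff_lt_or_eq.1 h with h | rfl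
    · exact ih H K u h hu
    · rcases Nat.lt_or_ge (finrank ℂ H) 3 with h3 | h3
      · rcases (by omega : finrank ℂ H = 0 ∨ finrank ℂ H = 1 ∨ finrank ℂ H = 2) with h | h | h
        · have := Module.finrank_zero_iff.1 h
          exact fun x _ => Subsingleton.elim _ _
        · exact transposeInjective_of_finrank_eq_one hu h
        · exact transposeInjective_of_finrank_eq_two hu ih h
      · exact transposeInjective_of_three_le hu ih h3

end Main

section Kronecker

variable {d : ℕ}

theorem isRankThreeUnitary_toEuclideanLin (R : Fin 3 → Matrix (Fin 3) (Fin 3) ℂ)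
    (S : Fin 3 → Matrix (Fin d) (Fin d) ℂ)
    (hU : ∑ i, R i ⊗ₖ S i ∈ Matrix.unitaryGroup (Fin 3 × Fin d) ℂ) :
    IsRankThreeUnitary fun a b => Matrix.toEuclideanLin (∑ i, R i a b • S i) where
  inner_columns b c x y := by
    have hmul : ∑ a, (∑ i, R i a b • S i)ᴴ * (∑ i, R i a c • S i) = if b = c then 1 else 0 := by
      ext p q
      have := congrFun (congrFun (Matrix.mem_unitaryGroup_iff'.1 hU) (b, p)) (c, q)
      simp only [Matrix.mul_apply, Matrix.star_apply, Fintype.sum_prod_type, Matrix.sum_apply,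
        Matrix.kroneckerMap_apply, Matrix.one_apply, Prod.mk.injEq] at this
      simp only [Matrix.sum_apply, Matrix.mul_apply, Matrix.conjTranspose_apply, Matrix.smul_apply,
        smul_eq_mul]
      rw [this]
      by_cases h : b = c <;> simp [h, Matrix.one_apply]
    simp only [← LinearMap.adjoint_inner_right, ← Matrix.toEuclideanLin_conjTranspose_eq_adjoint]
    rw [← inner_sum]
    have hy : ∑ a, Matrix.toEuclideanLin (∑ i, R i a b • S i)ᴴ
        (Matrix.toEuclideanLin (∑ i, R i a c • S i) y)
        = Matrix.toEuclideanLin (∑ a, (∑ i, R i a b • S i)ᴴ * (∑ i, R i a c • S i)) y := by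
      rw [map_sum, LinearMap.sum_apply]
      refine Finset.sum_congr rfl fun a _ => ?_
      simp [Matrix.toLpLin_apply, Matrix.mulVec_mulVec]
    rw [hy, hmul]
    split_ifs
    · simp
    · simp
  finrank_eq := rfl
  expansion := ⟨R, fun i => Matrix.toEuclideanLin (S i), fun a b => by simp [map_sum]⟩

theorem isUnit_sum_kronecker_transpose (R : Fin 3 → Matrix (Fin 3) (Fin 3) ℂ)
    (S : Fin 3 → Matrix (Fin d) (Fin d) ℂ)
    (hU : ∑ i, R i ⊗ₖ S i ∈ Matrix.unitaryGroup (Fin 3 × Fin d) ℂ) :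
    IsUnit (∑ i, R i ⊗ₖ (S i)ᵀ) := by
  rw [← Matrix.isUnit_transpose, ← Matrix.mulVec_injective_iff_isUnit]
  refine (injective_iff_map_eq_zero (Matrix.mulVecLin _)).2 fun x hx => ?_
  have hu := isRankThreeUnitary_toEuclideanLin R S hU
  have h0 := transposeInjectiveBelow _ _ _ _ (Nat.lt_succ_self _) hu
    (fun b => WithLp.toLp 2 fun q => x (b, q)) fun a => by
      ext p
      have := congrFun hx (a, p)
      simp only [Matrix.mulVecLin_apply, Matrix.mulVec, dotProduct, Matrix.transpose_apply,
        Matrix.sum_apply, Matrix.kroneckerMap_apply, Fintype.sum_prod_type, Pi.zero_apply] at this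
      simp only [WithLp.ofLp_sum, Finset.sum_apply, Matrix.toLpLin_apply, Matrix.mulVec, dotProduct,
        Matrix.sum_apply, Matrix.smul_apply, smul_eq_mul]
      exact this
  ext ⟨b, q⟩
  simpa using congrArg (fun z : EuclideanSpace ℂ (Fin d) => z q) (congrFun h0 b)

end Kronecker

theorem stmt_17 (d : ℕ)
    (R : Fin 3 → Matrix (Fin 3) (Fin 3) ℂ)
    (S : Fin 3 → Matrix (Fin d) (Fin d) ℂ)
    (U : Matrix (Fin 3 × Fin d) (Fin 3 × Fin d) ℂ)
    (hU : U ∈ Matrix.unitaryGroup (Fin 3 × Fin d) ℂ)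
    (hexp : U = ∑ i, R i ⊗ₖ S i) :
    (∑ i, R i ⊗ₖ (S i)ᵀ).rank = U.rank ∧ U.rank = 3 * d ∧
    (∑ i, R i ⊗ₖ (S i)ᵀ).rank ≤ 3 * U.rank := by
  have h₁ : U.rank = 3 * d := by
    rw [Matrix.rank_of_isUnit U (IsUnit.of_mul_eq_one _ (Matrix.mem_unitaryGroup_iff.1 hU))]
    simp
  have h₂ : (∑ i, R i ⊗ₖ (S i)ᵀ).rank = 3 * d := by
    rw [Matrix.rank_of_isUnit _ (isUnit_sum_kronecker_transpose R S (hexp ▸ hU))]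
    simp
  omega
end
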